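/- arXiv:2409.04387 — 11 statements merged into one kernel-verified Lean document; each statement's English description precedes it below -/
import Mathlib

section
/- Let Σ be an n×n real symmetric positive definite matrix, A an m×n real matrix with linearly independent rows, P = I − Σ Aᵀ (A Σ Aᵀ)⁻¹ A, v ∈ ℝⁿ, b = A v, and S_b = {x ∈ ℝⁿ : A x = b}. Then: (i) P μ + (I − P) v = μ for every μ ∈ S_b (so the estimator X ↦ P X + (I − P) v is unbiased for every mean μ ∈ S_b); (ii) P Σ Pᵀ = P Σ; and (iii) for every n×n real matrix L and every c ∈ ℝⁿ such that L μ + c = μ for all μ ∈ S_b, the matrix L Σ Lᵀ − P Σ Pᵀ is positive semidefinite. In other words, among all affine estimators X ↦ L X + c of the mean of a random vector X with covariance Σ and mean constrained to lie in S_b, the estimator μ̂ = P X + (I − P) v is unbiased and has the smallest covariance matrix in the positive semidefinite (Loewner) order, with Cov(μ̂) = P Σ. -/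
open Matrix

/-- constrained Gauss–Markov / BLUE property.  With
`P = I - Sig Aᵀ (A Sig Aᵀ)⁻¹ A`, `b = A v` and `S_b = {x | A x = b}`:
(i) the affine estimator `X ↦ P X + (I - P) v` is unbiased for every mean `μ ∈ S_b`;
(ii) its covariance is `P Sig Pᵀ = P Sig`;
(iii) for every affine estimator `X ↦ L X + c` that is unbiased on `S_b`,
`L Sig Lᵀ - P Sig Pᵀ` is positive semidefinite. -/
theorem stmt1 (n m : ℕ) (hn : 0 < n) (hm : 0 < m)
    (Sig : Matrix (Fin n) (Fin n) ℝ) (hSig : Sig.PosDef)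
    (A : Matrix (Fin m) (Fin n) ℝ) (hA : LinearIndependent ℝ (fun i => A i))
    (P : Matrix (Fin n) (Fin n) ℝ)
    (hP : P = 1 - Sig * Aᵀ * (A * Sig * Aᵀ)⁻¹ * A)
    (v : Fin n → ℝ) (b : Fin m → ℝ) (hb : b = A.mulVec v) :
    (∀ μ : Fin n → ℝ, A.mulVec μ = b → P.mulVec μ + (1 - P).mulVec v = μ) ∧
    P * Sig * Pᵀ = P * Sig ∧
    (∀ (L : Matrix (Fin n) (Fin n) ℝ) (c : Fin n → ℝ),
      (∀ μ : Fin n → ℝ, A.mulVec μ = b → L.mulVec μ + c = μ) →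
      (L * Sig * Lᵀ - P * Sig * Pᵀ).PosSemidef) := by
  have hST : Sigᵀ = Sig := by
    have h := hSig.isHermitian.eq
    rwa [conjTranspose_eq_transpose_of_trivial] at h
  have hM : (A * Sig * Aᵀ).PosDef := by
    have h := hSig.mul_mul_conjTranspose_same (B := A)
      (Matrix.vecMul_injective_iff.mpr hA)
    rwa [conjTranspose_eq_transpose_of_trivial] at h
  have hdet : IsUnit (A * Sig * Aᵀ).det := (Matrix.isUnit_iff_isUnit_det _).mp hM.isUnit
  have hMT : ((A * Sig * Aᵀ)⁻¹)ᵀ = (A * Sig * Aᵀ)⁻¹ := by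
    rw [transpose_nonsing_inv]
    simp only [transpose_mul, transpose_transpose, hST, Matrix.mul_assoc]
  have hAP : A * P = 0 := by
    have h : A * (Sig * Aᵀ * (A * Sig * Aᵀ)⁻¹ * A)
        = (A * Sig * Aᵀ) * (A * Sig * Aᵀ)⁻¹ * A := by
      simp only [Matrix.mul_assoc]
    rw [hP, Matrix.mul_sub, h, Matrix.mul_nonsing_inv _ hdet]
    simp
  have hPk : ∀ x : Fin n → ℝ, A.mulVec x = 0 → P.mulVec x = x := by
    intro x hx
    rw [hP, Matrix.sub_mulVec, ← Matrix.mulVec_mulVec, hx]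
    simp
  have hPP : P * P = P := by
    have h : P * P = (1 - Sig * Aᵀ * (A * Sig * Aᵀ)⁻¹ * A) * P := by rw [← hP]
    rw [h, Matrix.sub_mul, Matrix.mul_assoc _ A P, hAP]
    simp
  have hsym : Sig * Pᵀ = P * Sig := by
    rw [hP]
    simp only [transpose_sub, transpose_mul, transpose_one, transpose_transpose, hMT, hST]
    simp only [Matrix.mul_sub, Matrix.sub_mul, Matrix.mul_one, Matrix.one_mul, Matrix.mul_assoc]
  have h2 : P * Sig * Pᵀ = P * Sig := by
    rw [Matrix.mul_assoc, hsym, ← Matrix.mul_assoc, hPP]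
  refine ⟨?_, h2, ?_⟩
  · intro μ hμ
    have h := hPk (μ - v) (by rw [Matrix.mulVec_sub, hμ, hb, sub_self])
    rw [Matrix.mulVec_sub] at h
    rw [Matrix.sub_mulVec, Matrix.one_mulVec]
    have e : P *ᵥ μ + (v - P *ᵥ v) = (P *ᵥ μ - P *ᵥ v) + v := by abel
    rw [e, h, sub_add_cancel]
  · intro L c hL
    have hLk : ∀ x : Fin n → ℝ, A.mulVec x = 0 → L.mulVec x = x := by
      intro x hx
      have h0 := hL v hb.symm
      have h1 := hL (v + x) (by rw [Matrix.mulVec_add, hx, add_zero, hb])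
      rw [Matrix.mulVec_add] at h1
      have e : L *ᵥ x = (L *ᵥ v + L *ᵥ x + c) - (L *ᵥ v + c) := by abel
      rw [e, h1, h0, add_sub_cancel_left]
    have hLP : L * P = P := by
      refine Matrix.ext_of_mulVec_single fun i => ?_
      rw [← Matrix.mulVec_mulVec]
      apply hLk
      rw [Matrix.mulVec_mulVec, hAP, Matrix.zero_mulVec]
    have hLS : L * Sig * Pᵀ = P * Sig := by
      rw [Matrix.mul_assoc, hsym, ← Matrix.mul_assoc, hLP]
    have hPL : P * Sig * Lᵀ = P * Sig := by
      have h := congrArg Matrix.transpose hLS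
      simp only [transpose_mul, transpose_transpose, hST, hsym] at h
      rw [Matrix.mul_assoc]
      exact h
    have key : L * Sig * Lᵀ - P * Sig * Pᵀ = (L - P) * Sig * (L - P)ᴴ := by
      rw [conjTranspose_eq_transpose_of_trivial, transpose_sub]
      simp only [Matrix.sub_mul, Matrix.mul_sub, hLS, h2, hPL]
      abel
    rw [key]
    exact hSig.posSemidef.mul_mul_conjTranspose_same _
end

section
/- Let Σ be an n×n real symmetric positive definite matrix, A an m×n real matrix with linearly independent rows, P = I − Σ Aᵀ (A Σ Aᵀ)⁻¹ A, v ∈ ℝⁿ, and let μ ∈ ℝⁿ satisfy A μ = A v. Let γ be the Gaussian measure on ℝⁿ with mean μ and covariance matrix Σ. Then the pushforward of γ under the affine map x ↦ P x + (I − P) v is the Gaussian measure on ℝⁿ with mean μ and covariance matrix P Σ Pᵀ (which equals P Σ). -/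
open Matrix MeasureTheory

/-- `γ` is the Gaussian measure on `ℝⁿ` with mean `μ` and (symmetric positive semidefinite)
covariance matrix `C`: it is a Borel probability measure whose characteristic function is
`t ↦ exp(i tᵀ μ - tᵀ C t / 2)`. -/
def IsGaussianMeasure {n : ℕ} (γ : Measure (Fin n → ℝ)) (μ : Fin n → ℝ)
    (C : Matrix (Fin n) (Fin n) ℝ) : Prop :=
  IsProbabilityMeasure γ ∧
    ∀ t : Fin n → ℝ,
      ∫ x, Complex.exp (Complex.I * ((∑ i, t i * x i : ℝ) : ℂ)) ∂γ =
        Complex.exp (Complex.I * ((∑ i, t i * μ i : ℝ) : ℂ) -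
          ((∑ i, ∑ j, t i * C i j * t j : ℝ) : ℂ) / 2)

/-- If `γ` is Gaussian on `ℝⁿ` with mean `μ` and covariance `Sig`, where
`A μ = A v`, then the pushforward of `γ` under `x ↦ P x + (I - P) v`, with
`P = I - Sig Aᵀ (A Sig Aᵀ)⁻¹ A`, is the Gaussian measure with mean `μ` and covariance
`P Sig Pᵀ` (which equals `P Sig`). -/
theorem stmt2 (n m : ℕ) (hn : 0 < n) (hm : 0 < m)
    (Sig : Matrix (Fin n) (Fin n) ℝ) (hSig : Sig.PosDef)
    (A : Matrix (Fin m) (Fin n) ℝ) (hA : LinearIndependent ℝ (fun i => A i))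
    (P : Matrix (Fin n) (Fin n) ℝ)
    (hP : P = 1 - Sig * Aᵀ * (A * Sig * Aᵀ)⁻¹ * A)
    (v μ : Fin n → ℝ) (hμ : A.mulVec μ = A.mulVec v)
    (γ : Measure (Fin n → ℝ)) (hγ : IsGaussianMeasure γ μ Sig) :
    IsGaussianMeasure (γ.map (fun x => P.mulVec x + (1 - P).mulVec v)) μ (P * Sig * Pᵀ) ∧
    P * Sig * Pᵀ = P * Sig := by
  obtain ⟨hprob, hchar⟩ := hγ
  have hM : (A * Sig * Aᵀ).PosDef := by
    have h := hSig.mul_mul_conjTranspose_same (B := A)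
      (Matrix.vecMul_injective_iff.mpr hA)
    rwa [Matrix.conjTranspose_eq_transpose_of_trivial] at h
  have hdet : IsUnit (A * Sig * Aᵀ).det := (Matrix.isUnit_iff_isUnit_det _).mp hM.isUnit
  have hPA : P * Sig * Aᵀ = 0 := by
    have h : Sig * Aᵀ * (A * Sig * Aᵀ)⁻¹ * A * Sig * Aᵀ = Sig * Aᵀ := by
      calc Sig * Aᵀ * (A * Sig * Aᵀ)⁻¹ * A * Sig * Aᵀ
          = Sig * Aᵀ * ((A * Sig * Aᵀ)⁻¹ * (A * Sig * Aᵀ)) := by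
            simp only [Matrix.mul_assoc]
        _ = Sig * Aᵀ := by rw [Matrix.nonsing_inv_mul _ hdet, Matrix.mul_one]
    rw [hP, Matrix.sub_mul, Matrix.sub_mul, Matrix.one_mul, h, sub_self]
  have hcov : P * Sig * Pᵀ = P * Sig := by
    have hPt : Pᵀ = 1 - Aᵀ * (Sig * Aᵀ * (A * Sig * Aᵀ)⁻¹)ᵀ := by
      rw [hP, Matrix.transpose_sub, Matrix.transpose_one, Matrix.transpose_mul _ A]
    rw [hPt, Matrix.mul_sub, ← Matrix.mul_assoc, hPA, Matrix.zero_mul, Matrix.mul_one, sub_zero]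
  refine ⟨⟨?_, ?_⟩, hcov⟩
  · exact Measure.isProbabilityMeasure_map (by fun_prop)
  intro t
  have hv : (1 - P).mulVec v = (1 - P).mulVec μ := by
    have h : 1 - P = Sig * Aᵀ * (A * Sig * Aᵀ)⁻¹ * A := by rw [hP]; abel
    rw [h, ← Matrix.mulVec_mulVec v, ← Matrix.mulVec_mulVec μ, hμ]
  have hq : ∀ (C : Matrix (Fin n) (Fin n) ℝ) (s : Fin n → ℝ),
      (∑ i, ∑ j, s i * C i j * s j) = s ⬝ᵥ C *ᵥ s := by
    intro C s
    simp only [dotProduct, mulVec, Finset.mul_sum, mul_assoc]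
  have hd : ∀ (s x : Fin n → ℝ), (∑ i, s i * x i) = s ⬝ᵥ x := fun _ _ => rfl
  simp only [hq] at hchar ⊢
  simp only [hd] at hchar ⊢
  rw [integral_map (by fun_prop) (by
    apply Continuous.aestronglyMeasurable
    unfold dotProduct
    fun_prop), hv]
  have hx : ∀ x : Fin n → ℝ, t ⬝ᵥ (P *ᵥ x + (1 - P) *ᵥ μ)
      = t ⬝ᵥ (1 - P) *ᵥ μ + (t ᵥ* P) ⬝ᵥ x := by
    intro x
    rw [dotProduct_add, dotProduct_mulVec t P x, add_comm]
  simp only [hx, Complex.ofReal_add, mul_add, Complex.exp_add]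
  rw [integral_const_mul, hchar, ← Complex.exp_add]
  have h1 : t ⬝ᵥ μ = t ⬝ᵥ (1 - P) *ᵥ μ + (t ᵥ* P) ⬝ᵥ μ := by
    rw [← hx, ← Matrix.add_mulVec]; simp
  have h2 : (t ᵥ* P) ⬝ᵥ Sig *ᵥ (t ᵥ* P) = t ⬝ᵥ (P * Sig * Pᵀ) *ᵥ t := by
    rw [← Matrix.mulVec_mulVec, ← Matrix.mulVec_mulVec, Matrix.mulVec_transpose,
      dotProduct_mulVec t P]
  rw [h1, h2, Complex.ofReal_add]
  congr 1
  ring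
end

section
/- Fix a finite index set ι of 'variables' and, for each i ∈ ι, a nonempty finite type L i of 'levels'; let 𝒪 be a nonempty finite collection of subsets of ι, and for each S ∈ 𝒪 let σ²_S > 0. Consider coefficient families a = (a^S_v)_{S ∈ 𝒪, v ∈ V^S} of real numbers satisfying the unbiasedness constraint: Σ_{S ∈ 𝒪} a^S_{e|_S} = 1 for every e ∈ V^ι. Then for every such a, Σ_{S ∈ 𝒪} σ²_S · Σ_{v ∈ V^S} (a^S_v)² ≥ (Σ_{S ∈ 𝒪} (|V^S| σ²_S)⁻¹)⁻¹, and equality holds for the collection weights a^S_v = (|V^S| σ²_S)⁻¹ / (Σ_{R ∈ 𝒪} (|V^R| σ²_R)⁻¹) (which satisfy the constraint). Interpretation: if each observed table S carries uncorrelated noise of equal variance σ²_S per cell, the variance of any linear unbiased estimator of the total count is Σ_S σ²_S Σ_v (a^S_v)², so the collection estimate of the total — the inverse-variance weighted average of the observed table totals — is the best linear unbiased estimator of the total count. -/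
open Finset

variable {ι : Type*}

/-- The set of cells of a table on the variables in `S`: an element assigns to each
variable `i ∈ S` one of its levels in `L i`. -/
abbrev Cell (L : ι → Type*) (S : Finset ι) : Type _ := (i : S) → L i.1

/-- Restriction of a cell on `S` to a cell on `R`.  When `R ⊆ S` this is the genuine
restriction `v ↦ v|_R`; coordinates outside `S` (which never occur when `R ⊆ S`) are
filled with an arbitrary level. -/
noncomputable def restrictTo [DecidableEq ι] (L : ι → Type*) [∀ i, Nonempty (L i)]
    (S R : Finset ι) (w : Cell L S) : Cell L R :=
  fun i => if h : (i : ι) ∈ S then w ⟨i.1, h⟩ else Classical.arbitrary (L i.1)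

/-- The `R`-margin of a table `Z` on `S` at a cell `v ∈ V^R` (for `R ⊆ S`): the sum of
`Z w` over all cells `w` of `S` restricting to `v` on `R`. -/
noncomputable def margin [DecidableEq ι] (L : ι → Type*) [∀ i, Fintype (L i)]
    [∀ i, Nonempty (L i)] [∀ i, DecidableEq (L i)]
    (S R : Finset ι) (Z : Cell L S → ℝ) (v : Cell L R) : ℝ :=
  ∑ w : Cell L S, if restrictTo L S R w = v then Z w else 0


/-- Splitting a full cell into its restriction to `S` and the remaining coordinates. -/
noncomputable def splitCell [Fintype ι] [DecidableEq ι] (L : ι → Type*) [∀ i, Nonempty (L i)]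
    (S : Finset ι) :
    Cell L (univ : Finset ι) ≃ Cell L S × ((i : {i : ι // i ∉ S}) → L i.1) where
  toFun w := (restrictTo L univ S w, fun i => w ⟨i.1, mem_univ _⟩)
  invFun p := fun i => if h : i.1 ∈ S then p.1 ⟨i.1, h⟩ else p.2 ⟨i.1, h⟩
  left_inv w := by
    funext i
    by_cases h : i.1 ∈ S <;> simp [restrictTo, h]
  right_inv p := by
    refine Prod.ext ?_ ?_
    · funext i
      simp [restrictTo]
    · funext i
      simp [i.2]

theorem sum_restrict [Fintype ι] [DecidableEq ι] (L : ι → Type*) [∀ i, Fintype (L i)]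
    [∀ i, Nonempty (L i)] (S : Finset ι) (f : Cell L S → ℝ) :
    ∑ e : Cell L (univ : Finset ι), f (restrictTo L univ S e) =
      (Fintype.card (Cell L (univ : Finset ι)) : ℝ) *
        ((∑ v, f v) / (Fintype.card (Cell L S) : ℝ)) := by
  have h1 : ∑ e : Cell L (univ : Finset ι), f (restrictTo L univ S e) =
      ∑ p : Cell L S × ((i : {i : ι // i ∉ S}) → L i.1), f p.1 :=
    Fintype.sum_equiv (splitCell L S) _ _ (fun _ => rfl)
  have h2 : (Fintype.card (Cell L S) : ℝ) ≠ 0 := by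
    exact_mod_cast Fintype.card_ne_zero
  rw [h1, Fintype.card_congr (splitCell L S), Fintype.card_prod, Fintype.sum_prod_type]
  simp only [sum_const, card_univ, nsmul_eq_mul, ← mul_sum]
  push_cast
  field_simp

/-- the collection estimate of the total is BLUE.  Suppose each observed
table `S ∈ 𝒪` carries uncorrelated noise of equal variance `σ² S > 0` per cell, so that a
linear unbiased estimator of the total with coefficients `a` (satisfying
`∑_{S ∈ 𝒪} a^S_{e|_S} = 1` for every detailed cell `e`) has variance
`∑_S σ² S ∑_v (a^S_v)²`.  Then this variance is at least
`(∑_S (|V^S| σ² S)⁻¹)⁻¹`, and the inverse-variance collection weights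
`a^S_v = (|V^S| σ² S)⁻¹ / ∑_R (|V^R| σ² R)⁻¹` satisfy the unbiasedness constraint and
attain this bound. -/
theorem stmt5 [Fintype ι] [DecidableEq ι] (L : ι → Type*) [∀ i, Fintype (L i)]
    [∀ i, Nonempty (L i)] [∀ i, DecidableEq (L i)]
    (𝒪 : Finset (Finset ι)) (h𝒪 : 𝒪.Nonempty)
    (σsq : Finset ι → ℝ) (hσ : ∀ S ∈ 𝒪, 0 < σsq S) :
    (∀ a : (S : Finset ι) → Cell L S → ℝ,
      (∀ e : Cell L (univ : Finset ι), ∑ S ∈ 𝒪, a S (restrictTo L univ S e) = 1) →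
      (∑ S ∈ 𝒪, ((Fintype.card (Cell L S) : ℝ) * σsq S)⁻¹)⁻¹ ≤
        ∑ S ∈ 𝒪, σsq S * ∑ v : Cell L S, (a S v) ^ 2) ∧
    (∀ e : Cell L (univ : Finset ι),
      ∑ S ∈ 𝒪, ((Fintype.card (Cell L S) : ℝ) * σsq S)⁻¹ /
        (∑ R ∈ 𝒪, ((Fintype.card (Cell L R) : ℝ) * σsq R)⁻¹) = 1) ∧
    (∑ S ∈ 𝒪, σsq S * ∑ _v : Cell L S,
        (((Fintype.card (Cell L S) : ℝ) * σsq S)⁻¹ /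
          (∑ R ∈ 𝒪, ((Fintype.card (Cell L R) : ℝ) * σsq R)⁻¹)) ^ 2 =
      (∑ S ∈ 𝒪, ((Fintype.card (Cell L S) : ℝ) * σsq S)⁻¹)⁻¹) := by
  have hn : ∀ S : Finset ι, 0 < (Fintype.card (Cell L S) : ℝ) := fun S => by
    exact_mod_cast Fintype.card_pos
  have hp : ∀ S ∈ 𝒪, 0 < ((Fintype.card (Cell L S) : ℝ) * σsq S)⁻¹ := fun S hS =>
    inv_pos.mpr (mul_pos (hn S) (hσ S hS))
  have hW : 0 < ∑ S ∈ 𝒪, ((Fintype.card (Cell L S) : ℝ) * σsq S)⁻¹ := sum_pos hp h𝒪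
  refine ⟨fun a ha => ?_, fun _ => ?_, ?_⟩
  · have hm : ∑ S ∈ 𝒪, (∑ v, a S v) / (Fintype.card (Cell L S) : ℝ) = 1 := by
      have h := Finset.sum_congr (rfl : (univ : Finset (Cell L (univ : Finset ι))) = univ)
        (fun e _ => ha e)
      rw [sum_comm] at h
      simp only [sum_restrict, ← mul_sum, sum_const, card_univ, nsmul_eq_mul, mul_one] at h
      exact (mul_eq_left₀ (hn univ).ne').mp h
    have hcs := Finset.sum_sq_le_sum_mul_sum_of_sq_eq_mul 𝒪
      (r := fun S => (∑ v, a S v) / (Fintype.card (Cell L S) : ℝ))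
      (f := fun S => ((Fintype.card (Cell L S) : ℝ) * σsq S)⁻¹)
      (g := fun S => (Fintype.card (Cell L S) : ℝ) * σsq S *
        ((∑ v, a S v) / (Fintype.card (Cell L S) : ℝ)) ^ 2)
      (fun S hS => (hp S hS).le)
      (fun S hS => mul_nonneg (mul_pos (hn S) (hσ S hS)).le (sq_nonneg _))
      (fun S hS => by
        have := (mul_pos (hn S) (hσ S hS)).ne'
        rw [inv_mul_cancel_left₀ this])
    rw [hm, one_pow] at hcs
    rw [inv_le_iff_one_le_mul₀' hW]
    refine hcs.trans (mul_le_mul_of_nonneg_left (sum_le_sum fun S hS => ?_) hW.le)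
    have hc : (∑ v, a S v) ^ 2 ≤ (Fintype.card (Cell L S) : ℝ) * ∑ v, (a S v) ^ 2 := by
      simpa using sq_sum_le_card_mul_sum_sq (s := (univ : Finset (Cell L S))) (f := a S)
    have e : (Fintype.card (Cell L S) : ℝ) * σsq S *
        ((∑ v, a S v) / (Fintype.card (Cell L S) : ℝ)) ^ 2 =
        σsq S * ((∑ v, a S v) ^ 2 / (Fintype.card (Cell L S) : ℝ)) := by
      have := (hn S).ne'
      field_simp
    rw [e]
    refine mul_le_mul_of_nonneg_left ?_ (hσ S hS).le
    rw [div_le_iff₀' (hn S)]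
    exact hc
  · rw [← sum_div, div_self hW.ne']
  · have key : ∀ S ∈ 𝒪, σsq S * ∑ _v : Cell L S,
        (((Fintype.card (Cell L S) : ℝ) * σsq S)⁻¹ /
          (∑ R ∈ 𝒪, ((Fintype.card (Cell L R) : ℝ) * σsq R)⁻¹)) ^ 2 =
        ((Fintype.card (Cell L S) : ℝ) * σsq S)⁻¹ /
          (∑ R ∈ 𝒪, ((Fintype.card (Cell L R) : ℝ) * σsq R)⁻¹) ^ 2 := fun S hS => by
      generalize (∑ R ∈ 𝒪, ((Fintype.card (Cell L R) : ℝ) * σsq R)⁻¹) = W at hW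
      rw [sum_const, card_univ, nsmul_eq_mul]
      have h1 := (hn S).ne'
      have h2 := (hσ S hS).ne'
      have h3 := hW.ne'
      generalize (Fintype.card (Cell L S) : ℝ) = n at h1
      field_simp
    rw [sum_congr rfl key, ← sum_div]
    have h3 := hW.ne'
    field_simp
end

section
/- Fix a finite index set ι of 'variables' and, for each i ∈ ι, a nonempty finite type L i of 'levels', and let S ⊆ ι. Suppose (Ŷ^R)_{R ⊊ S} is a self-consistent family of tables indexed by the proper subsets of S, and define the table Ẑ^S on S by Ẑ^S_v = Σ_{R ⊊ S} (−1)^{|S∖R|+1} (∏_{i ∈ S∖R} |L i|)⁻¹ · Ŷ^R_{v|_R} (the sum over all proper subsets R of S). Then for every proper subset R ⊊ S and every v ∈ V^R, the R-margin of Ẑ^S at v equals Ŷ^R_v. -/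
open Finset

variable {ι : Type*}

/-- The table `Z^S` built from a family `Y = (Y^R)_{R ⊊ S}` of tables on the proper subsets
of `S`:  `Z^S_v = ∑_{R ⊊ S} (−1)^{|S∖R|+1} (∏_{i ∈ S∖R} |L i|)⁻¹ · Y^R_{v|_R}`. -/
noncomputable def zTable [DecidableEq ι] (L : ι → Type*) [∀ i, Fintype (L i)]
    [∀ i, Nonempty (L i)]
    (S : Finset ι) (Y : (R : Finset ι) → Cell L R → ℝ) : Cell L S → ℝ :=
  fun v => ∑ R ∈ S.powerset.erase S,
    (-1 : ℝ) ^ ((S \ R).card + 1) * (∏ i ∈ S \ R, (Fintype.card (L i) : ℝ))⁻¹ *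
      Y R (restrictTo L S R v)

theorem aux_restrict_eq_iff [DecidableEq ι] (L : ι → Type*) [∀ i, Nonempty (L i)]
    (S R : Finset ι) (hR : R ⊆ S) (w : Cell L S) (v : Cell L R) :
    restrictTo L S R w = v ↔ ∀ i (hi : i ∈ R), w ⟨i, hR hi⟩ = v ⟨i, hi⟩ := by
  constructor
  · rintro rfl i hi
    simp [restrictTo, hR hi]
  · intro h
    funext i
    simp [restrictTo, hR i.2, h i.1 i.2]

theorem aux_count [DecidableEq ι] (L : ι → Type*) [∀ i, Fintype (L i)]
    [∀ i, Nonempty (L i)] [∀ i, DecidableEq (L i)]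
    (S R T : Finset ι) (hR : R ⊆ S) (hT : T ⊆ S) (v : Cell L R) (u : Cell L T) :
    (∑ w : Cell L S, if restrictTo L S R w = v ∧ restrictTo L S T w = u then (1 : ℝ) else 0)
      = if restrictTo L T (T ∩ R) u = restrictTo L R (T ∩ R) v then
        ∏ i ∈ S \ (R ∪ T), (Fintype.card (L i) : ℝ) else 0 := by
  have hiff : restrictTo L T (T ∩ R) u = restrictTo L R (T ∩ R) v ↔
      ∀ i (hi : i ∈ T) (hi' : i ∈ R), u ⟨i, hi⟩ = v ⟨i, hi'⟩ := by
    rw [aux_restrict_eq_iff L T (T ∩ R) inter_subset_left]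
    constructor
    · intro h i hi hi'
      have := h i (mem_inter.2 ⟨hi, hi'⟩)
      simpa [restrictTo, hi'] using this
    · intro h i hi
      have hi' := (mem_inter.1 hi).2
      simpa [restrictTo, hi'] using h i (mem_inter.1 hi).1 hi'
  rw [← Finset.sum_filter, Finset.sum_const, nsmul_eq_mul, mul_one]
  split_ifs with hc
  · rw [hiff] at hc
    have : (univ.filter fun w : Cell L S => restrictTo L S R w = v ∧ restrictTo L S T w = u)
        = Fintype.piFinset (fun i : S => if h : i.1 ∈ R then ({v ⟨i.1, h⟩} : Finset (L i.1)) else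
            if h : i.1 ∈ T then ({u ⟨i.1, h⟩} : Finset (L i.1)) else (univ : Finset (L i.1))) := by
      ext w
      simp only [mem_filter, mem_univ, true_and, Fintype.mem_piFinset,
        aux_restrict_eq_iff L S R hR, aux_restrict_eq_iff L S T hT]
      constructor
      · rintro ⟨h1, h2⟩ i
        split_ifs with a b
        · simpa using h1 i.1 a
        · simpa using h2 i.1 b
        · simp
      · intro h
        have h1 : ∀ i (hi : i ∈ R), w ⟨i, hR hi⟩ = v ⟨i, hi⟩ := by
          intro i hi
          simpa [hi] using h ⟨i, hR hi⟩
        refine ⟨h1, fun i hi => ?_⟩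
        by_cases hi' : i ∈ R
        · rw [h1 i hi', hc i hi hi']
        · simpa [hi, hi'] using h ⟨i, hT hi⟩
    rw [this, Fintype.card_piFinset, Nat.cast_prod]
    have h2 : ∀ i : S, (((if h : i.1 ∈ R then ({v ⟨i.1, h⟩} : Finset (L i.1)) else
            if h : i.1 ∈ T then ({u ⟨i.1, h⟩} : Finset (L i.1)) else (univ : Finset (L i.1))).card : ℕ) : ℝ)
          = (fun j : ι => if j ∈ R ∪ T then (1 : ℝ) else (Fintype.card (L j) : ℝ)) i.1 := by
      intro i
      by_cases a : i.1 ∈ R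
      · simp [a]
      · by_cases b : i.1 ∈ T
        · simp [a, b]
        · simp [a, b]
    rw [Finset.prod_congr rfl (fun i _ => h2 i), Finset.prod_coe_sort S
      (fun j : ι => if j ∈ R ∪ T then (1 : ℝ) else (Fintype.card (L j) : ℝ)),
      Finset.sdiff_eq_filter, Finset.prod_filter]
    refine Finset.prod_congr rfl fun i _ => ?_
    by_cases a : i ∈ R ∪ T <;> simp only [a, if_true, if_false, not_true, not_false_iff]
  · rw [Nat.cast_eq_zero, Finset.card_eq_zero, Finset.filter_eq_empty_iff]
    rintro w - ⟨h1, h2⟩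
    rw [aux_restrict_eq_iff L S R hR] at h1
    rw [aux_restrict_eq_iff L S T hT] at h2
    exact hc (hiff.2 fun i hi hi' => by rw [← h1 i hi', ← h2 i hi])

theorem aux_margin [DecidableEq ι] (L : ι → Type*) [∀ i, Fintype (L i)]
    [∀ i, Nonempty (L i)] [∀ i, DecidableEq (L i)]
    (S R T : Finset ι) (hR : R ⊆ S) (hT : T ⊆ S) (v : Cell L R) (g : Cell L T → ℝ) :
    (∑ w : Cell L S, if restrictTo L S R w = v then g (restrictTo L S T w) else 0)
      = (∏ i ∈ S \ (R ∪ T), (Fintype.card (L i) : ℝ)) *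
        margin L T (T ∩ R) g (restrictTo L R (T ∩ R) v) := by
  have h1 : ∀ w : Cell L S, (if restrictTo L S R w = v then g (restrictTo L S T w) else 0)
      = ∑ u : Cell L T, g u *
        (if restrictTo L S R w = v ∧ restrictTo L S T w = u then (1 : ℝ) else 0) := by
    intro w
    by_cases h : restrictTo L S R w = v <;> simp [h]
  simp_rw [h1]
  rw [Finset.sum_comm, margin, Finset.mul_sum]
  refine Finset.sum_congr rfl fun u _ => ?_
  rw [← Finset.mul_sum, aux_count L S R T hR hT]
  split_ifs <;> ring

/-- If `(Ŷ^R)_{R ⊊ S}` is a self-consistent family of tables on the proper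
subsets of `S` and `Ẑ^S_v = ∑_{R ⊊ S} (−1)^{|S∖R|+1} (∏_{i ∈ S∖R} |L i|)⁻¹ Ŷ^R_{v|_R}`,
then for every proper subset `R ⊊ S` and every `v ∈ V^R`, the `R`-margin of `Ẑ^S` at `v`
equals `Ŷ^R_v`. -/
theorem stmt6 [Fintype ι] [DecidableEq ι] (L : ι → Type*) [∀ i, Fintype (L i)]
    [∀ i, Nonempty (L i)] [∀ i, DecidableEq (L i)]
    (S : Finset ι) (Yhat : (R : Finset ι) → Cell L R → ℝ)
    (hsc : ∀ R R' : Finset ι, R ⊂ S → R' ⊆ R →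
      ∀ v : Cell L R', margin L R R' (Yhat R) v = Yhat R' v) :
    ∀ R : Finset ι, R ⊂ S →
      ∀ v : Cell L R, margin L S R (zTable L S Yhat) v = Yhat R v := by
  intro R hRS v
  obtain ⟨a, haS, haR⟩ := Finset.exists_of_ssubset hRS
  have hR := hRS.subset
  let f : Finset ι → ℝ := fun T => (-1 : ℝ) ^ ((S \ T).card + 1) *
    (∏ i ∈ R \ T, (Fintype.card (L i) : ℝ))⁻¹ * Yhat (T ∩ R) (restrictTo L R (T ∩ R) v)
  have hpos : ∀ A : Finset ι, (∏ i ∈ A, (Fintype.card (L i) : ℝ)) ≠ 0 := fun A =>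
    Finset.prod_ne_zero_iff.2 fun i _ => Nat.cast_ne_zero.2 Fintype.card_ne_zero
  have hsum : margin L S R (zTable L S Yhat) v = ∑ T ∈ S.powerset.erase S, f T := by
    unfold margin zTable
    have : ∀ w : Cell L S, (if restrictTo L S R w = v then
        ∑ T ∈ S.powerset.erase S, (-1 : ℝ) ^ ((S \ T).card + 1) *
          (∏ i ∈ S \ T, (Fintype.card (L i) : ℝ))⁻¹ * Yhat T (restrictTo L S T w) else 0)
        = ∑ T ∈ S.powerset.erase S, (-1 : ℝ) ^ ((S \ T).card + 1) *
          (∏ i ∈ S \ T, (Fintype.card (L i) : ℝ))⁻¹ *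
          (if restrictTo L S R w = v then Yhat T (restrictTo L S T w) else 0) := by
      intro w
      split_ifs <;> simp
    rw [Finset.sum_congr rfl fun w _ => this w, Finset.sum_comm]
    refine Finset.sum_congr rfl fun T hT => ?_
    have hTS : T ⊆ S := Finset.mem_powerset.1 (Finset.mem_of_mem_erase hT)
    have hTss : T ⊂ S := hTS.ssubset_of_ne (Finset.ne_of_mem_erase hT)
    rw [← Finset.mul_sum, aux_margin L S R T hR hTS, hsc T (T ∩ R) hTss inter_subset_left]
    have hsplit : (∏ i ∈ S \ T, (Fintype.card (L i) : ℝ)) =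
        (∏ i ∈ S \ (R ∪ T), (Fintype.card (L i) : ℝ)) *
          ∏ i ∈ R \ T, (Fintype.card (L i) : ℝ) := by
      rw [← Finset.prod_union]
      · congr 1
        ext i
        have := @hR i
        simp only [mem_sdiff, mem_union]
        tauto
      · rw [Finset.disjoint_left]
        intro i
        simp only [mem_sdiff, mem_union]
        tauto
    simp only [f]
    rw [hsplit]
    have h1 := hpos (S \ (R ∪ T))
    have h2 := hpos (R \ T)
    field_simp
  have hzero : ∑ T ∈ S.powerset, f T = 0 := by
    conv_lhs => rw [← Finset.insert_erase haS]
    rw [Finset.sum_powerset_insert (Finset.notMem_erase a S), ← Finset.sum_add_distrib]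
    refine Finset.sum_eq_zero fun T hT => ?_
    have hTa : a ∉ T := fun h => Finset.notMem_erase a S (Finset.mem_powerset.1 hT h)
    have e1 : insert a T ∩ R = T ∩ R := Finset.insert_inter_of_notMem haR
    have e2 : R \ insert a T = R \ T := by
      ext i
      simp only [mem_sdiff, mem_insert]
      constructor
      · tauto
      · rintro ⟨h1, h2⟩
        refine ⟨h1, ?_⟩
        rintro (rfl | h)
        · exact haR h1
        · exact h2 h
    have e3 : (S \ T).card = (S \ insert a T).card + 1 := by
      rw [Finset.sdiff_insert, Finset.card_erase_add_one]
      exact Finset.mem_sdiff.2 ⟨haS, hTa⟩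
    simp only [f]
    rw [e1, e2, e3]
    ring
  have hfS : f S = - Yhat R v := by
    have e : S ∩ R = R := Finset.inter_eq_right.2 hR
    have e2 : R \ S = ∅ := Finset.sdiff_eq_empty_iff_subset.2 hR
    have e3 : restrictTo L R R v = v :=
      (aux_restrict_eq_iff L R R subset_rfl v v).2 fun _ _ => rfl
    simp only [f]
    rw [e, e2, e3]
    simp
  have := Finset.sum_erase_add S.powerset f (Finset.mem_powerset_self S)
  rw [hsum]
  linarith
end

section
/- Fix a finite index set ι of 'variables' and, for each i ∈ ι, a nonempty finite type L i of 'levels', and let S ⊆ ι. Suppose (Ŷ^R)_{R ⊊ S} is a self-consistent family of tables indexed by the proper subsets of S, and define the table Ẑ^S on S by Ẑ^S_v = Σ_{R ⊊ S} (−1)^{|S∖R|+1} (∏_{i ∈ S∖R} |L i|)⁻¹ · Ŷ^R_{v|_R}. Then Ẑ^S lies in the orthogonal complement of the zero-margin subspace 𝒮_S: for every table Z⁰ on S whose R-margins vanish for all proper subsets R ⊊ S, one has Σ_{v ∈ V^S} Z⁰_v · Ẑ^S_v = 0. -/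
open Finset

variable {ι : Type*}

/-- If `(Ŷ^R)_{R ⊊ S}` is a self-consistent family of tables on the proper
subsets of `S` and `Ẑ^S_v = ∑_{R ⊊ S} (−1)^{|S∖R|+1} (∏_{i ∈ S∖R} |L i|)⁻¹ Ŷ^R_{v|_R}`,
then `Ẑ^S` is orthogonal to the zero-margin subspace `𝒮_S`: for every table `Z⁰` on `S`
all of whose proper margins vanish, `∑_{v ∈ V^S} Z⁰_v Ẑ^S_v = 0`. -/
theorem stmt7 [Fintype ι] [DecidableEq ι] (L : ι → Type*) [∀ i, Fintype (L i)]
    [∀ i, Nonempty (L i)] [∀ i, DecidableEq (L i)]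
    (S : Finset ι) (Yhat : (R : Finset ι) → Cell L R → ℝ)
    (hsc : ∀ R R' : Finset ι, R ⊂ S → R' ⊆ R →
      ∀ v : Cell L R', margin L R R' (Yhat R) v = Yhat R' v) :
    ∀ Z0 : Cell L S → ℝ,
      (∀ R : Finset ι, R ⊂ S → ∀ v : Cell L R, margin L S R Z0 v = 0) →
      ∑ v : Cell L S, Z0 v * zTable L S Yhat v = 0 := by
  intro Z0 hZ
  have key : ∀ R ∈ S.powerset.erase S,
      ∑ v : Cell L S, Z0 v * Yhat R (restrictTo L S R v) = 0 := by
    intro R hR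
    have hRS : R ⊂ S := by
      rw [Finset.mem_erase, Finset.mem_powerset] at hR
      exact Finset.ssubset_iff_subset_ne.mpr ⟨hR.2, hR.1⟩
    have h1 : ∑ u : Cell L R, margin L S R Z0 u * Yhat R u = 0 :=
      Finset.sum_eq_zero fun u _ => by rw [hZ R hRS u, zero_mul]
    rw [← h1]
    simp only [margin, Finset.sum_mul]
    rw [Finset.sum_comm]
    refine Finset.sum_congr rfl fun v _ => ?_
    simp [ite_mul]
  simp only [zTable, Finset.mul_sum]
  rw [Finset.sum_comm]
  refine Finset.sum_eq_zero fun R hR => ?_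
  simp only [mul_left_comm (Z0 _)]
  rw [← Finset.mul_sum, key R hR, mul_zero]
end

section
/- Fix a finite index set ι of 'variables' and, for each i ∈ ι, a nonempty finite type L i of 'levels', and let S ⊆ ι. For a table Ý on S, define the table Ź^S on S by Ź^S_v = Σ_{R ⊊ S} (−1)^{|S∖R|+1} (∏_{i ∈ S∖R} |L i|)⁻¹ · (the R-margin of Ý at v|_R). Then Ź^S lies in the orthogonal complement 𝒮_S^⊥ of the zero-margin subspace and Ý − Ź^S lies in 𝒮_S; consequently, Ź^S is the image of Ý under the orthogonal projection (with respect to the standard inner product) of the space of tables on S onto 𝒮_S^⊥, and Ý − Ź^S is its image under the orthogonal projection onto 𝒮_S. -/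
open Finset

variable {ι : Type*}

theorem restrictTo_eq_iff [DecidableEq ι] (L : ι → Type*) [∀ i, Nonempty (L i)]
    (S R : Finset ι) (w v : Cell L S) :
    restrictTo L S R w = restrictTo L S R v ↔ ∀ j : S, j.1 ∈ R → w j = v j := by
  constructor
  · intro h j hj
    have := congrFun h ⟨j.1, hj⟩
    simpa [restrictTo] using this
  · intro h
    funext j
    by_cases hj : j.1 ∈ S
    · simpa [restrictTo, hj] using h ⟨j.1, hj⟩ j.2
    · simp [restrictTo, hj]

theorem sum_update_cell [DecidableEq ι] (L : ι → Type*) [∀ i, Fintype (L i)]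
    (S : Finset ι) (i : S) (F : Cell L S → ℝ) :
    (Fintype.card (L i.1) : ℝ) * ∑ w : Cell L S, F w
      = ∑ w : Cell L S, ∑ a : L i.1, F (Function.update w i a) := by
  have h1 : ∑ p : Cell L S × L i.1, F p.1
      = ∑ p : Cell L S × L i.1, F (Function.update p.1 i p.2) := by
    have hinv : Function.Involutive
        (fun p : Cell L S × L i.1 => ((Function.update p.1 i p.2, p.1 i) : Cell L S × L i.1)) := by
      intro p
      simp
    exact (Equiv.sum_comp hinv.toPerm (fun p : Cell L S × L i.1 => F p.1)).symm
  rw [Fintype.sum_prod_type, Fintype.sum_prod_type] at h1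
  rw [← h1]
  simp [Finset.mul_sum]

theorem sum_margin_insert [DecidableEq ι] (L : ι → Type*) [∀ i, Fintype (L i)]
    [∀ i, Nonempty (L i)] [∀ i, DecidableEq (L i)]
    (S R : Finset ι) (i : S) (hi : i.1 ∉ R) (Y : Cell L S → ℝ) (v : Cell L S) :
    ∑ a : L i.1, margin L S (insert i.1 R) Y
        (restrictTo L S (insert i.1 R) (Function.update v i a))
      = margin L S R Y (restrictTo L S R v) := by
  unfold margin
  rw [Finset.sum_comm]
  refine Finset.sum_congr rfl fun w _ => ?_
  have key : ∀ a : L i.1, (restrictTo L S (insert i.1 R) w =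
      restrictTo L S (insert i.1 R) (Function.update v i a)) ↔
      (w i = a ∧ restrictTo L S R w = restrictTo L S R v) := by
    intro a
    rw [restrictTo_eq_iff, restrictTo_eq_iff]
    constructor
    · intro h
      refine ⟨by simpa using h i (by simp), fun j hj => ?_⟩
      have hne : j ≠ i := by rintro rfl; exact hi hj
      simpa [hne] using h j (by simp [hj])
    · rintro ⟨h1, h2⟩ j hj
      by_cases hji : j = i
      · subst hji; simpa using h1
      · have : j.1 ∈ R := by
          rcases Finset.mem_insert.1 hj with h | h
          · exact absurd (Subtype.ext h) hji
          · exact h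
        simpa [hji] using h2 j this
  simp only [key, ite_and]
  simp

theorem margin_update [DecidableEq ι] (L : ι → Type*) [∀ i, Nonempty (L i)]
    (S R : Finset ι) (i : S) (hi : i.1 ∉ R) (v : Cell L S) (a : L i.1) :
    restrictTo L S R (Function.update v i a) = restrictTo L S R v := by
  rw [restrictTo_eq_iff]
  intro j hj
  have hne : j ≠ i := by rintro rfl; exact hi hj
  simp [hne]

theorem sub_zTable_eq [DecidableEq ι] (L : ι → Type*) [∀ i, Fintype (L i)]
    [∀ i, Nonempty (L i)] [∀ i, DecidableEq (L i)]
    (S : Finset ι) (Y : Cell L S → ℝ) (v : Cell L S) :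
    Y v - zTable L S (fun R => margin L S R Y) v
      = ∑ R ∈ S.powerset, (-1 : ℝ) ^ (S \ R).card *
          (∏ i ∈ S \ R, (Fintype.card (L i) : ℝ))⁻¹ *
          margin L S R Y (restrictTo L S R v) := by
  rw [← Finset.add_sum_erase _ _ (Finset.mem_powerset_self S)]
  have h : margin L S S Y (restrictTo L S S v) = Y v := by
    unfold margin
    have : ∀ w : Cell L S, (restrictTo L S S w = restrictTo L S S v) ↔ w = v := by
      intro w
      rw [restrictTo_eq_iff]
      exact ⟨fun h => funext fun j => h j j.2, fun h j _ => by rw [h]⟩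
    simp [this]
  unfold zTable
  simp only [h, Finset.sdiff_self, Finset.card_empty, pow_zero, Finset.prod_empty, inv_one,
    one_mul, sub_eq_add_neg, ← Finset.sum_neg_distrib]
  congr 1
  refine Finset.sum_congr rfl fun R _ => ?_
  ring

theorem sum_update_sub_zTable [DecidableEq ι] (L : ι → Type*) [∀ i, Fintype (L i)]
    [∀ i, Nonempty (L i)] [∀ i, DecidableEq (L i)]
    (S : Finset ι) (Y : Cell L S → ℝ) (v : Cell L S) (i : S) :
    ∑ a : L i.1, (Y (Function.update v i a)
      - zTable L S (fun R => margin L S R Y) (Function.update v i a)) = 0 := by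
  simp only [sub_zTable_eq]
  rw [Finset.sum_comm]
  simp only [← Finset.mul_sum]
  have hS : S.powerset = (insert i.1 (S.erase i.1)).powerset := by
    rw [Finset.insert_erase i.2]
  rw [hS, Finset.sum_powerset_insert (Finset.notMem_erase _ _), ← Finset.sum_add_distrib]
  refine Finset.sum_eq_zero fun R hR => ?_
  have hRS := Finset.mem_powerset.1 hR
  have hiR : i.1 ∉ R := fun h => Finset.notMem_erase _ _ (hRS h)
  rw [sum_margin_insert L S R i hiR]
  simp only [margin_update L S R i hiR]
  have hd : S \ R = insert i.1 (S \ insert i.1 R) := by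
    ext j
    have := i.2
    by_cases hj : j = i.1
    · subst hj; simp [hiR]
    · simp [hj]
  have hn : i.1 ∉ S \ insert i.1 R := by simp
  rw [hd, Finset.card_insert_of_notMem hn, Finset.prod_insert hn]
  have hc : (Fintype.card (L i.1) : ℝ) ≠ 0 := by
    exact_mod_cast Fintype.card_ne_zero
  simp only [Finset.sum_const, Finset.card_univ, nsmul_eq_mul, mul_inv]
  field_simp
  ring

/-- For a table `Ý` on `S`, let
`Ź^S_v = ∑_{R ⊊ S} (−1)^{|S∖R|+1} (∏_{i ∈ S∖R} |L i|)⁻¹ · (R-margin of Ý at v|_R)`.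
Then `Ź^S ∈ 𝒮_S^⊥` (it is orthogonal to every table with vanishing proper margins) and
`Ý − Ź^S ∈ 𝒮_S` (all its proper margins vanish); consequently `Ź^S` is the orthogonal
projection of `Ý` onto `𝒮_S^⊥` and `Ý − Ź^S` its orthogonal projection onto `𝒮_S`. -/
theorem stmt8 [Fintype ι] [DecidableEq ι] (L : ι → Type*) [∀ i, Fintype (L i)]
    [∀ i, Nonempty (L i)] [∀ i, DecidableEq (L i)]
    (S : Finset ι) (Yac : Cell L S → ℝ) :
    (∀ Z0 : Cell L S → ℝ,
      (∀ R : Finset ι, R ⊂ S → ∀ v : Cell L R, margin L S R Z0 v = 0) →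
      ∑ v : Cell L S, Z0 v * zTable L S (fun R => margin L S R Yac) v = 0) ∧
    (∀ R : Finset ι, R ⊂ S → ∀ v : Cell L R,
      margin L S R (fun w => Yac w - zTable L S (fun R' => margin L S R' Yac) w) v = 0) := by
  constructor
  · intro Z0 hZ
    unfold zTable
    simp only [Finset.mul_sum]
    rw [Finset.sum_comm]
    refine Finset.sum_eq_zero fun R hR => ?_
    have hRS : R ⊂ S := by
      rw [Finset.mem_erase, Finset.mem_powerset] at hR
      exact Finset.ssubset_iff_subset_ne.2 ⟨hR.2, hR.1⟩
    have h : ∀ g : Cell L R → ℝ, ∑ v : Cell L S, Z0 v * g (restrictTo L S R v) = 0 := by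
      intro g
      have h1 : ∑ u : Cell L R, margin L S R Z0 u * g u = 0 :=
        Finset.sum_eq_zero fun u _ => by rw [hZ R hRS u, zero_mul]
      rw [← h1]
      unfold margin
      simp only [Finset.sum_mul]
      rw [Finset.sum_comm]
      refine Finset.sum_congr rfl fun w _ => ?_
      simp [ite_mul]
    exact h (fun u => (-1 : ℝ) ^ ((S \ R).card + 1) *
      (∏ i ∈ S \ R, (Fintype.card (L i) : ℝ))⁻¹ * margin L S R Yac u)
  · intro R hR v
    obtain ⟨i, hiS, hiR⟩ := Finset.exists_of_ssubset hR
    have hc : (Fintype.card (L i) : ℝ) ≠ 0 := by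
      exact_mod_cast Fintype.card_ne_zero
    refine (mul_eq_zero.1 ?_).resolve_left hc
    unfold margin
    refine (sum_update_cell L S ⟨i, hiS⟩ _).trans ?_
    refine Finset.sum_eq_zero fun w _ => ?_
    simp only [margin_update L S R ⟨i, hiS⟩ hiR]
    split_ifs
    · exact sum_update_sub_zTable L S Yac w ⟨i, hiS⟩
    · simp
end

section
/- Fix a finite index set ι of 'variables' and, for each i ∈ ι, a nonempty finite type L i of 'levels', and let S ⊆ ι. Let P be the linear operator on tables on S sending a table X to the table P X defined by (P X)_v = Σ_{R ⊊ S} (−1)^{|S∖R|+1} (∏_{i ∈ S∖R} |L i|)⁻¹ · (the R-margin of X at v|_R). Then P is self-adjoint with respect to the standard inner product: for all tables X and Y on S, Σ_{v ∈ V^S} (P X)_v · Y_v = Σ_{v ∈ V^S} X_v · (P Y)_v. -/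
open Finset

variable {ι : Type*}

/-- The linear operator `P` on tables on `S` given by
`(P X)_v = ∑_{R ⊊ S} (−1)^{|S∖R|+1} (∏_{i ∈ S∖R} |L i|)⁻¹ · (R-margin of X at v|_R)`
is self-adjoint with respect to the standard inner product:
`∑_v (P X)_v Y_v = ∑_v X_v (P Y)_v` for all tables `X, Y` on `S`. -/
theorem stmt9 [Fintype ι] [DecidableEq ι] (L : ι → Type*) [∀ i, Fintype (L i)]
    [∀ i, Nonempty (L i)] [∀ i, DecidableEq (L i)]
    (S : Finset ι) :
    ∀ X Y : Cell L S → ℝ,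
      ∑ v : Cell L S, zTable L S (fun R => margin L S R X) v * Y v =
        ∑ v : Cell L S, X v * zTable L S (fun R => margin L S R Y) v := by
  intro X Y
  simp only [zTable, margin, Finset.sum_mul, Finset.mul_sum]
  rw [Finset.sum_comm]
  conv_rhs => rw [Finset.sum_comm]
  refine Finset.sum_congr rfl fun R _ => ?_
  rw [Finset.sum_comm]
  refine Finset.sum_congr rfl fun v _ => Finset.sum_congr rfl fun w _ => ?_
  by_cases h : restrictTo L S R v = restrictTo L S R w
  · rw [if_pos h, if_pos h.symm]
    ring
  · rw [if_neg h, if_neg (Ne.symm h)]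
    ring
end

section
/- Fix a finite index set ι of 'variables' and, for each i ∈ ι, a nonempty finite type L i of 'levels', and let S ⊆ ι. Let (Ŷ^R)_{R ⊊ S} be a self-consistent family of tables indexed by the proper subsets of S, let Ẑ^S be the table with Ẑ^S_v = Σ_{R ⊊ S} (−1)^{|S∖R|+1} (∏_{i ∈ S∖R} |L i|)⁻¹ · Ŷ^R_{v|_R}, let Ý be any table on S, and let Ź^S be the table with Ź^S_v = Σ_{R ⊊ S} (−1)^{|S∖R|+1} (∏_{i ∈ S∖R} |L i|)⁻¹ · (the R-margin of Ý at v|_R). Set Ŷ^S = Ý − Ź^S + Ẑ^S. Then: (i) for every R ⊊ S the R-margin of Ŷ^S equals Ŷ^R; and (ii) for every table X on S whose R-margin equals Ŷ^R for all R ⊊ S, Σ_{v ∈ V^S} (Ŷ^S_v − Ý_v)² ≤ Σ_{v ∈ V^S} (X_v − Ý_v)². That is, Ŷ^S is the Euclidean (least-squares) projection of Ý onto the affine set of tables on S whose proper margins agree with the family (Ŷ^R). -/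
open Finset

variable {ι : Type*}

section helpers
variable [DecidableEq ι] (L : ι → Type*) [∀ i, Fintype (L i)]
    [∀ i, Nonempty (L i)] [∀ i, DecidableEq (L i)]

lemma restrictTo_comp (S R Q : Finset ι) (hR : R ⊆ S) (hQ : Q ⊆ R) (w : Cell L S) :
    restrictTo L R Q (restrictTo L S R w) = restrictTo L S Q w := by
  funext i
  have h1 : (i : ι) ∈ R := hQ i.2
  simp [restrictTo, h1, hR h1]

lemma sum_mul_restrict (S R : Finset ι) (W : Cell L S → ℝ) (h : Cell L R → ℝ) :
    ∑ v, W v * h (restrictTo L S R v) = ∑ x, h x * margin L S R W x := by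
  simp only [margin, Finset.mul_sum]
  rw [Finset.sum_comm]
  refine Finset.sum_congr rfl fun w _ => ?_
  simp [mul_comm]

lemma margin_margin (S R Q : Finset ι) (hR : R ⊆ S) (hQ : Q ⊆ R) (Z : Cell L S → ℝ)
    (v : Cell L Q) : margin L R Q (margin L S R Z) v = margin L S Q Z v := by
  have := sum_mul_restrict L S R Z (fun x => if restrictTo L R Q x = v then 1 else 0)
  simp only [restrictTo_comp L S R Q hR hQ] at this
  simpa [margin] using this.symm

lemma count_fiber (S R T : Finset ι) (hR : R ⊆ S) (hT : T ⊆ S) (x : Cell L R) (u : Cell L T) :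
    (∑ w : Cell L S, if restrictTo L S T w = u then
      (if restrictTo L S R w = x then (1 : ℝ) else 0) else 0) =
    if restrictTo L R (R ∩ T) x = restrictTo L T (R ∩ T) u then
      ∏ i ∈ S \ (R ∪ T), (Fintype.card (L i) : ℝ) else 0 := by
  split_ifs with hc
  · have key : ∀ w : Cell L S, (restrictTo L S T w = u ∧ restrictTo L S R w = x) ↔
        w ∈ Fintype.piFinset (fun i : S => if h : (i : ι) ∈ T then ({u ⟨i, h⟩} : Finset (L i))
          else if h : (i : ι) ∈ R then {x ⟨i, h⟩} else Finset.univ) := by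
      intro w
      rw [Fintype.mem_piFinset]
      constructor
      · rintro ⟨rfl, rfl⟩ i
        split_ifs <;> simp [restrictTo]
      · intro h
        constructor
        · funext i
          have := h ⟨i, hT i.2⟩
          simpa [restrictTo, hT i.2] using this
        · funext i
          have h1 := h ⟨i, hR i.2⟩
          by_cases hi : (i : ι) ∈ T
          · have h2 := congrFun hc ⟨i, Finset.mem_inter.2 ⟨i.2, hi⟩⟩
            simp only [restrictTo, hi, i.2, dif_pos] at h2
            simp only [hi, dif_pos, Finset.mem_singleton] at h1
            simp only [restrictTo, hR i.2, dif_pos]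
            rw [h1, ← h2]
          · simpa [restrictTo, hR i.2, hi] using h1
    simp only [← ite_and, key]
    rw [← Finset.sum_filter]
    simp only [Finset.filter_mem_eq_inter, Finset.univ_inter, Finset.sum_const, nsmul_eq_mul,
      mul_one, Fintype.card_piFinset]
    push_cast
    have : ∀ i : S, (((if h : (i : ι) ∈ T then ({u ⟨i, h⟩} : Finset (L i))
          else if h : (i : ι) ∈ R then {x ⟨i, h⟩} else Finset.univ).card : ℕ) : ℝ) =
          (fun j : ι => if j ∈ R ∪ T then (1 : ℝ) else (Fintype.card (L j) : ℝ)) i := by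
      intro i
      by_cases h1 : (i : ι) ∈ T <;> by_cases h2 : (i : ι) ∈ R <;> simp [h1, h2]
    rw [Finset.prod_congr rfl (fun i _ => this i), Finset.prod_coe_sort S
      (fun j : ι => if j ∈ R ∪ T then (1 : ℝ) else (Fintype.card (L j) : ℝ)),
      Finset.sdiff_eq_filter, Finset.prod_filter]
    refine Finset.prod_congr rfl fun i _ => ?_
    by_cases h : i ∈ R ∪ T <;> simp only [h, if_true, if_false, not_true, not_false_eq_true]
  · refine Finset.sum_eq_zero fun w _ => ?_
    split_ifs with h1 h2
    · exfalso
      apply hc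
      rw [← h1, ← h2, restrictTo_comp L S R _ hR Finset.inter_subset_left,
        restrictTo_comp L S T _ hT Finset.inter_subset_right]
    all_goals rfl

lemma margin_lift (S R T : Finset ι) (hR : R ⊆ S) (hT : T ⊆ S) (F : Cell L R → ℝ)
    (u : Cell L T) :
    margin L S T (fun w => F (restrictTo L S R w)) u =
      (∏ i ∈ S \ (R ∪ T), (Fintype.card (L i) : ℝ)) *
        margin L R (R ∩ T) F (restrictTo L T (R ∩ T) u) := by
  have h1 : margin L S T (fun w => F (restrictTo L S R w)) u =
      ∑ x, F x * ∑ w : Cell L S, if restrictTo L S T w = u then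
      (if restrictTo L S R w = x then (1 : ℝ) else 0) else 0 := by
    have := sum_mul_restrict L S R (fun w => if restrictTo L S T w = u then 1 else 0) F
    simp only [margin] at this ⊢
    simp only [ite_mul, one_mul, zero_mul] at this
    rw [this]
    refine Finset.sum_congr rfl fun x _ => ?_
    congr 1
    refine Finset.sum_congr rfl fun w _ => ?_
    split_ifs <;> rfl
  rw [h1, margin, Finset.mul_sum]
  refine Finset.sum_congr rfl fun x _ => ?_
  rw [count_fiber L S R T hR hT]
  split_ifs
  · ring
  · simp

lemma alt_sum (S T : Finset ι) (hT : T ⊂ S) (g : Finset ι → ℝ) :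
    ∑ R ∈ S.powerset, (-1 : ℝ) ^ ((S \ R).card + 1) * g (R ∩ T) = 0 := by
  obtain ⟨hTS, a, haS, haT⟩ := Finset.ssubset_iff_exists_cons_subset.1 hT |> fun ⟨a, h, h'⟩ =>
    (⟨hT.1, a, h' (Finset.mem_cons_self _ _), h⟩ : T ⊆ S ∧ ∃ a, a ∈ S ∧ a ∉ T)
  rw [← Finset.insert_erase haS, Finset.sum_powerset_insert (Finset.notMem_erase a S),
    ← Finset.sum_add_distrib]
  refine Finset.sum_eq_zero fun R hR => ?_
  have haR : a ∉ R := fun h => Finset.notMem_erase a S (Finset.mem_powerset.1 hR h)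
  have e1 : insert a R ∩ T = R ∩ T := Finset.insert_inter_of_notMem haT
  have e2 : insert a (S.erase a) \ insert a R = S.erase a \ R := by
    ext j; simp only [mem_sdiff, mem_insert, mem_erase]; grind
  have e3 : insert a (S.erase a) \ R = insert a (S.erase a \ R) :=
    Finset.insert_sdiff_of_notMem _ haR
  rw [e1, e2, e3, Finset.card_insert_of_notMem (by simp)]
  ring

lemma margin_add_sub (S T : Finset ι) (A B C : Cell L S → ℝ) (u : Cell L T) :
    margin L S T (fun v => A v - B v + C v) u =
      margin L S T A u - margin L S T B u + margin L S T C u := by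
  simp only [margin]
  rw [← Finset.sum_sub_distrib, ← Finset.sum_add_distrib]
  refine Finset.sum_congr rfl fun w _ => ?_
  split_ifs <;> simp

lemma margin_zTable (S T : Finset ι) (hT : T ⊂ S) (Y : (R : Finset ι) → Cell L R → ℝ)
    (hsc : ∀ R R' : Finset ι, R ⊂ S → R' ⊆ R →
      ∀ v : Cell L R', margin L R R' (Y R) v = Y R' v) (u : Cell L T) :
    margin L S T (zTable L S Y) u = Y T u := by
  set g : Finset ι → ℝ := fun Q => (∏ i ∈ T \ Q, (Fintype.card (L i) : ℝ))⁻¹ *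
    Y Q (restrictTo L T Q u) with hg
  have h1 : margin L S T (zTable L S Y) u = ∑ R ∈ S.powerset.erase S,
      (-1 : ℝ) ^ ((S \ R).card + 1) * (∏ i ∈ S \ R, (Fintype.card (L i) : ℝ))⁻¹ *
      margin L S T (fun w => Y R (restrictTo L S R w)) u := by
    simp only [margin, zTable, Finset.mul_sum]
    rw [Finset.sum_comm]
    refine Finset.sum_congr rfl fun w _ => ?_
    split_ifs <;> simp
  have h2 : margin L S T (zTable L S Y) u = ∑ R ∈ S.powerset.erase S,
      (-1 : ℝ) ^ ((S \ R).card + 1) * g (R ∩ T) := by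
    rw [h1]
    refine Finset.sum_congr rfl fun R hR => ?_
    obtain ⟨hne, hRS⟩ := Finset.mem_erase.1 hR
    have hRS := Finset.mem_powerset.1 hRS
    rw [margin_lift L S R T hRS hT.1, hsc R _ (hRS.ssubset_of_ne hne) Finset.inter_subset_left,
      mul_assoc]
    congr 1
    simp only [hg]
    rw [← mul_assoc]
    congr 1
    have e : S \ R = (S \ (R ∪ T)) ∪ (T \ (R ∩ T)) := by
      ext j
      have := @hT.1 j
      simp only [mem_sdiff, mem_union, mem_inter]; grind
    have hd : Disjoint (S \ (R ∪ T)) (T \ (R ∩ T)) := by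
      rw [Finset.disjoint_left]; intro j; simp only [mem_sdiff, mem_union, mem_inter]; grind
    rw [e, Finset.prod_union hd]
    have p : (∏ i ∈ S \ (R ∪ T), (Fintype.card (L i) : ℝ)) ≠ 0 :=
      Finset.prod_ne_zero_iff.2 fun i _ => by exact_mod_cast Fintype.card_ne_zero
    rw [mul_inv, mul_comm, ← mul_assoc, mul_inv_cancel₀ p, one_mul]
  have h3 := alt_sum S T hT g
  rw [← Finset.add_sum_erase _ _ (Finset.mem_powerset_self S), ← h2,
    Finset.inter_eq_right.2 hT.1] at h3
  have h4 : restrictTo L T T u = u := by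
    funext i; simp [restrictTo]
  simp [hg, h4] at h3
  linarith

lemma orth_zTable (S : Finset ι) (Y : (R : Finset ι) → Cell L R → ℝ) (W : Cell L S → ℝ)
    (hW : ∀ R, R ⊂ S → ∀ v, margin L S R W v = 0) :
    ∑ v, W v * zTable L S Y v = 0 := by
  simp only [zTable, Finset.mul_sum]
  rw [Finset.sum_comm]
  refine Finset.sum_eq_zero fun R hR => ?_
  obtain ⟨hne, hRS⟩ := Finset.mem_erase.1 hR
  have hRS := (Finset.mem_powerset.1 hRS).ssubset_of_ne hne
  have := sum_mul_restrict L S R W (fun x => (-1 : ℝ) ^ ((S \ R).card + 1) *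
    (∏ i ∈ S \ R, (Fintype.card (L i) : ℝ))⁻¹ * Y R x)
  rw [this]
  simp [hW R hRS]

end helpers

/-- the down-pass step.  Let `(Ŷ^R)_{R ⊊ S}` be a self-consistent family,
`Ẑ^S` the table built from it, `Ý` any table on `S`, and `Ź^S` the table built from the
margins of `Ý`.  Then `Ŷ^S = Ý − Ź^S + Ẑ^S` has `R`-margin `Ŷ^R` for every `R ⊊ S`, and
among all tables whose proper margins agree with the family `(Ŷ^R)`, it minimizes the
squared Euclidean distance to `Ý`: it is the least-squares projection of `Ý` onto that
affine set. -/
theorem stmt10 [Fintype ι] [DecidableEq ι] (L : ι → Type*) [∀ i, Fintype (L i)]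
    [∀ i, Nonempty (L i)] [∀ i, DecidableEq (L i)]
    (S : Finset ι) (Yhat : (R : Finset ι) → Cell L R → ℝ)
    (hsc : ∀ R R' : Finset ι, R ⊂ S → R' ⊆ R →
      ∀ v : Cell L R', margin L R R' (Yhat R) v = Yhat R' v)
    (Yac : Cell L S → ℝ)
    (YhatS : Cell L S → ℝ)
    (hYhatS : YhatS = fun v =>
      Yac v - zTable L S (fun R => margin L S R Yac) v + zTable L S Yhat v) :
    (∀ R : Finset ι, R ⊂ S →
      ∀ v : Cell L R, margin L S R YhatS v = Yhat R v) ∧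
    (∀ X : Cell L S → ℝ,
      (∀ R : Finset ι, R ⊂ S → ∀ v : Cell L R, margin L S R X v = Yhat R v) →
      ∑ v : Cell L S, (YhatS v - Yac v) ^ 2 ≤ ∑ v : Cell L S, (X v - Yac v) ^ 2) := by
  have hm : ∀ R : Finset ι, R ⊂ S →
      ∀ v : Cell L R, margin L S R YhatS v = Yhat R v := by
    intro R hR v
    rw [hYhatS, margin_add_sub, margin_zTable L S R hR Yhat hsc,
      margin_zTable L S R hR (fun R => margin L S R Yac)
        (fun R R' h h' v => margin_margin L S R R' h.1 h' Yac v)]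
    ring
  refine ⟨hm, fun X hX => ?_⟩
  have hW : ∀ R, R ⊂ S → ∀ v, margin L S R (fun w => X w - YhatS w + 0) v = 0 := by
    intro R hR v
    rw [margin_add_sub L S R X YhatS (fun _ => 0), hX R hR, hm R hR]
    simp [margin]
  have o1 := orth_zTable L S Yhat _ hW
  have o2 := orth_zTable L S (fun R => margin L S R Yac) _ hW
  have e : ∑ v : Cell L S, (X v - Yac v) ^ 2 = ∑ v : Cell L S, (YhatS v - Yac v) ^ 2 +
      ∑ v : Cell L S, (X v - YhatS v) ^ 2 +
      2 * (∑ v, (X v - YhatS v + 0) * zTable L S Yhat v -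
        ∑ v, (X v - YhatS v + 0) * zTable L S (fun R => margin L S R Yac) v) := by
    rw [← Finset.sum_sub_distrib, Finset.mul_sum, ← Finset.sum_add_distrib,
      ← Finset.sum_add_distrib]
    refine Finset.sum_congr rfl fun v _ => ?_
    have : YhatS v = Yac v - zTable L S (fun R => margin L S R Yac) v + zTable L S Yhat v := by
      rw [hYhatS]
    have h' : zTable L S Yhat v =
        YhatS v - Yac v + zTable L S (fun R => margin L S R Yac) v := by rw [this]; ring
    rw [h']
    ring
  rw [e, o1, o2]
  have : 0 ≤ ∑ v : Cell L S, (X v - YhatS v) ^ 2 := Finset.sum_nonneg fun v _ => sq_nonneg _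
  linarith
end

section
/- Let k be a nonnegative integer and let n₁, …, n_k be positive integers. Consider the real vector space of tables Z : ∏_{j=1}^k Fin(n_j) → ℝ, and let 𝒮 be the subspace of tables all of whose proper margins vanish, i.e., tables Z such that for every proper subset R ⊊ {1,…,k} and every v ∈ ∏_{j ∈ R} Fin(n_j), the sum of Z over all cells restricting to v on R is zero. Then the dimension of 𝒮 equals ∏_{j=1}^k (n_j − 1). -/
/-- The linear functional sending a table `Z : ∏_j Fin (n j) → ℝ` to its `R`-margin at
`v`: the sum of `Z w` over all cells `w` whose restriction to `R` equals `v`. -/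
noncomputable def marginMap {k : ℕ} (n : Fin k → ℕ) (R : Finset (Fin k))
    (v : (j : R) → Fin (n j.1)) : ((∀ j, Fin (n j)) → ℝ) →ₗ[ℝ] ℝ where
  toFun Z := ∑ w : ∀ j, Fin (n j), if (∀ j : R, w j.1 = v j) then Z w else 0
  map_add' Z W := by
    rw [← Finset.sum_add_distrib]
    exact Finset.sum_congr rfl fun w _ => by split <;> simp
  map_smul' c Z := by
    simp only [Pi.smul_apply, smul_eq_mul, RingHom.id_apply]
    rw [Finset.mul_sum]
    exact Finset.sum_congr rfl fun w _ => by split <;> simp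

/-- The zero-margin subspace `𝒮`: tables all of whose proper margins vanish. -/
noncomputable def zeroMarginSpace {k : ℕ} (n : Fin k → ℕ) :
    Submodule ℝ ((∀ j, Fin (n j)) → ℝ) :=
  ⨅ (R : Finset (Fin k)) (_ : R ≠ Finset.univ) (v : (j : R) → Fin (n j.1)),
    LinearMap.ker (marginMap n R v)

/-- Tables whose single-variable sums all vanish. -/
def lineSpace {k : ℕ} (n : Fin k → ℕ) : Submodule ℝ ((∀ j, Fin (n j)) → ℝ) where
  carrier := {Z | ∀ (j : Fin k) (w : ∀ j, Fin (n j)), ∑ a, Z (Function.update w j a) = 0}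
  add_mem' := by
    intro a b ha hb j w
    simp [Finset.sum_add_distrib, ha j w, hb j w]
  zero_mem' := by intro j w; simp
  smul_mem' := by
    intro c a ha j w
    simp [← Finset.mul_sum, ha j w]

lemma mem_lineSpace {k : ℕ} {n : Fin k → ℕ} {Z : (∀ j, Fin (n j)) → ℝ} :
    Z ∈ lineSpace n ↔
      ∀ (j : Fin k) (w : ∀ j, Fin (n j)), ∑ a, Z (Function.update w j a) = 0 := Iff.rfl

lemma zeroMarginSpace_eq {k : ℕ} (n : Fin k → ℕ) (hn : ∀ j, 0 < n j) :
    zeroMarginSpace n = lineSpace n := by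
  ext Z
  simp only [zeroMarginSpace, Submodule.mem_iInf, LinearMap.mem_ker, mem_lineSpace]
  constructor
  · intro h j w
    have h1 := h (Finset.univ.erase j) (by
      intro h; have := Finset.mem_univ j; rw [← h] at this; simp at this) (fun i => w i.1)
    rw [← h1]
    simp only [marginMap, LinearMap.coe_mk, AddHom.coe_mk]
    rw [← Finset.sum_filter]
    refine Finset.sum_bij (fun a _ => Function.update w j a) ?_ ?_ ?_ ?_
    · intro a _
      simp only [Finset.mem_filter, Finset.mem_univ, true_and]
      rintro ⟨i, hi⟩
      exact Function.update_of_ne (Finset.ne_of_mem_erase hi) _ _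
    · intro a _ b _ hab
      simpa using congrFun hab j
    · intro b hb
      simp only [Finset.mem_filter, Finset.mem_univ, true_and] at hb
      refine ⟨b j, Finset.mem_univ _, ?_⟩
      ext1 i
      by_cases hi : i = j
      · subst hi; simp
      · rw [Function.update_of_ne hi]
        exact (hb ⟨i, by simp [hi]⟩).symm
    · intros; rfl
  · intro h R hR v
    obtain ⟨j, hj⟩ : ∃ j, j ∉ R := by
      by_contra! hc
      exact hR (Finset.eq_univ_iff_forall.2 hc)
    simp only [marginMap, LinearMap.coe_mk, AddHom.coe_mk]
    rw [← (Equiv.piSplitAt j (fun i => Fin (n i))).symm.sum_comp, Fintype.sum_prod_type_right]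
    refine Finset.sum_eq_zero fun y _ => ?_
    set w : ∀ i, Fin (n i) := (Equiv.piSplitAt j (fun i => Fin (n i))).symm (⟨0, hn j⟩, y) with hw
    have key : ∀ a, (Equiv.piSplitAt j (fun i => Fin (n i))).symm (a, y) =
        Function.update w j a := by
      intro a
      ext1 i
      by_cases hi : i = j
      · subst hi; simp [Equiv.piSplitAt]
      · simp [hw, Equiv.piSplitAt, hi]
    simp only [key]
    have hc : ∀ a, (∀ i : R, Function.update w j a i.1 = v i) ↔ ∀ i : R, w i.1 = v i := by
      intro a
      refine forall_congr' fun i => ?_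
      rw [Function.update_of_ne]
      rintro rfl
      exact hj i.2
    simp only [hc]
    split_ifs
    · exact h j w
    · simp

/-- The sum map on families. -/
def sumMap (m : ℕ) (V : Type*) [AddCommGroup V] [Module ℝ V] : (Fin m → V) →ₗ[ℝ] V where
  toFun f := ∑ a, f a
  map_add' f g := by simp [Finset.sum_add_distrib]
  map_smul' c f := by simp [Finset.smul_sum]

lemma finrank_ker_sumMap (m : ℕ) (hm : 0 < m) (V : Type*) [AddCommGroup V] [Module ℝ V]
    [FiniteDimensional ℝ V] :
    Module.finrank ℝ (LinearMap.ker (sumMap m V)) = (m - 1) * Module.finrank ℝ V := by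
  have h := LinearMap.finrank_range_add_finrank_ker (sumMap m V)
  have hs : LinearMap.range (sumMap m V) = ⊤ := by
    rw [LinearMap.range_eq_top]
    intro x
    exact ⟨Pi.single ⟨0, hm⟩ x, by simp [sumMap]⟩
  rw [hs, finrank_top, Module.finrank_pi_fintype] at h
  simp only [Finset.sum_const, Finset.card_univ, Fintype.card_fin, smul_eq_mul] at h
  rw [Nat.sub_mul]
  omega

lemma mem_lineSpace_succ {k : ℕ} (n : Fin (k + 1) → ℕ) (Z : (∀ j, Fin (n j)) → ℝ) :
    Z ∈ lineSpace n ↔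
      (∀ a : Fin (n 0), (fun w : ∀ j : Fin k, Fin (n j.succ) =>
        Z (Fin.cons (α := fun j => Fin (n j)) a w)) ∈ lineSpace (fun j : Fin k => n j.succ)) ∧
      ∀ w : ∀ j : Fin k, Fin (n j.succ),
        ∑ a : Fin (n 0), Z (Fin.cons (α := fun j => Fin (n j)) a w) = 0 := by
  simp only [mem_lineSpace]
  constructor
  · intro h
    refine ⟨fun a j w => ?_, fun w => ?_⟩
    · simp only [Fin.cons_update]
      exact h j.succ _
    · by_cases hz : Nonempty (Fin (n 0))
      · obtain ⟨a⟩ := hz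
        have := h 0 (Fin.cons (α := fun j => Fin (n j)) a w)
        simpa only [Fin.update_cons_zero] using this
      · rw [not_nonempty_iff] at hz
        simp
  · rintro ⟨h1, h2⟩ j w
    rw [← Fin.cons_self_tail w]
    refine Fin.cases ?_ (fun j => ?_) j
    · simp only [Fin.update_cons_zero]
      exact h2 _
    · simp only [← Fin.cons_update]
      exact h1 _ j _

/-- Slicing along the first variable. -/
def sliceEquiv {k : ℕ} (n : Fin (k + 1) → ℕ) :
    lineSpace n ≃ₗ[ℝ]
      LinearMap.ker (sumMap (n 0) (lineSpace (fun j : Fin k => n j.succ))) where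
  toFun Z := ⟨fun a => ⟨fun w => Z.1 (Fin.cons (α := fun j => Fin (n j)) a w),
      ((mem_lineSpace_succ n Z.1).1 Z.2).1 a⟩, by
    rw [LinearMap.mem_ker]
    ext w
    simpa [sumMap] using ((mem_lineSpace_succ n Z.1).1 Z.2).2 w⟩
  map_add' _ _ := rfl
  map_smul' _ _ := rfl
  invFun f := ⟨fun w => (f.1 (w 0)).1 (Fin.tail w), by
    rw [mem_lineSpace_succ]
    refine ⟨fun a => ?_, fun w => ?_⟩
    · simpa using (f.1 a).2
    · have := congrArg (fun x => x.1 w) (LinearMap.mem_ker.1 f.2)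
      simpa [sumMap] using this⟩
  left_inv Z := by
    ext w
    simp
  right_inv f := by
    ext a w
    simp

lemma finrank_lineSpace {k : ℕ} (n : Fin k → ℕ) (hn : ∀ j, 0 < n j) :
    Module.finrank ℝ (lineSpace n) = ∏ j, (n j - 1) := by
  induction k with
  | zero =>
    have : lineSpace n = ⊤ := by
      ext Z
      simp [mem_lineSpace]
    rw [this, finrank_top]
    simp
  | succ k ih =>
    rw [(sliceEquiv n).finrank_eq, finrank_ker_sumMap _ (hn 0), ih _ (fun j => hn j.succ),
      Fin.prod_univ_succ]

/-- The subspace of tables on `k` variables (with `n j ≥ 1` levels for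
variable `j`) all of whose proper margins vanish has dimension `∏_j (n j − 1)`. -/
theorem stmt11 {k : ℕ} (n : Fin k → ℕ) (hn : ∀ j, 0 < n j) :
    Module.finrank ℝ (zeroMarginSpace n) = ∏ j, (n j - 1) := by
  rw [zeroMarginSpace_eq n hn, finrank_lineSpace n hn]
end

section
/- Let k be a nonnegative integer and let n₁, …, n_k be positive integers, with levels of variable j labelled 1, …, n_j. For each choice (i_j)_{j=1}^k with 1 ≤ i_j ≤ n_j − 1, define the table Z^{(i_j)} : ∏_{j=1}^k {1,…,n_j} → ℝ by Z^{(i_j)}_v = ∏_{j=1}^k ((−1)^{[v_j = i_j + 1]} · [v_j ∈ {i_j, i_j + 1}]), where [·] denotes the indicator (so the j-th factor is 1 if v_j = i_j, −1 if v_j = i_j + 1, and 0 otherwise). Then the ∏_{j=1}^k (n_j − 1) tables Z^{(i_j)} are linearly independent and span the subspace 𝒮 of tables all of whose proper margins vanish; i.e., they form a basis of 𝒮. -/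
/-- The candidate basis tables: for a choice `i` with `i j ∈ {0, …, n j − 2}` for each
variable `j`, the table whose entry at `v` is `∏_j ([v j = i j] − [v j = i j + 1])`
(the `j`-th factor is `1` if `v j = i j`, `−1` if `v j = i j + 1`, and `0` otherwise). -/
noncomputable def basisTable {k : ℕ} (n : Fin k → ℕ) (i : (j : Fin k) → Fin (n j - 1)) :
    (∀ j, Fin (n j)) → ℝ :=
  fun v => ∏ j, (if (v j : ℕ) = (i j : ℕ) then (1 : ℝ)
    else if (v j : ℕ) = (i j : ℕ) + 1 then -1 else 0)

theorem one_dim (m a : ℕ) (i : Fin (m - 1)) :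
    (∑ x : Fin m, if (x : ℕ) ≤ a then (if (x : ℕ) = (i : ℕ) then (1 : ℝ)
      else if (x : ℕ) = (i : ℕ) + 1 then -1 else 0) else 0) = if (i : ℕ) = a then 1 else 0 := by
  have hi := i.2
  have h1 : ∀ x : Fin m, (if (x : ℕ) ≤ a then (if (x : ℕ) = (i : ℕ) then (1 : ℝ)
      else if (x : ℕ) = (i : ℕ) + 1 then -1 else 0) else 0)
      = (if x = ⟨i, by omega⟩ then (if (i : ℕ) ≤ a then (1 : ℝ) else 0) else 0)
        - (if x = ⟨i + 1, by omega⟩ then (if (i : ℕ) + 1 ≤ a then (1 : ℝ) else 0) else 0) := by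
    intro x
    simp only [Fin.ext_iff]
    split_ifs <;> first | omega | simp
  rw [Finset.sum_congr rfl fun x _ => h1 x, Finset.sum_sub_distrib, Finset.sum_ite_eq',
    Finset.sum_ite_eq']
  simp only [Finset.mem_univ, if_true]
  split_ifs <;> first | omega | simp

theorem one_dim_total (m : ℕ) (i : Fin (m - 1)) :
    (∑ x : Fin m, (if (x : ℕ) = (i : ℕ) then (1 : ℝ)
      else if (x : ℕ) = (i : ℕ) + 1 then -1 else 0)) = 0 := by
  have h := one_dim m m i
  rw [if_neg (by omega)] at h
  refine Eq.trans ?_ h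
  exact Finset.sum_congr rfl fun x _ => (if_pos x.2.le).symm

/-- Cumulative sums of a table. -/
noncomputable def cumMap {k : ℕ} (n : Fin k → ℕ) (c : Fin k → ℕ) :
    ((∀ j, Fin (n j)) → ℝ) →ₗ[ℝ] ℝ where
  toFun Z := ∑ w : ∀ j, Fin (n j), if (∀ j, (w j : ℕ) ≤ c j) then Z w else 0
  map_add' Z W := by
    rw [← Finset.sum_add_distrib]
    exact Finset.sum_congr rfl fun w _ => by split <;> simp
  map_smul' c Z := by
    simp only [Pi.smul_apply, smul_eq_mul, RingHom.id_apply]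
    rw [Finset.mul_sum]
    exact Finset.sum_congr rfl fun w _ => by split <;> simp

theorem sum_prod_fac {k : ℕ} (n : Fin k → ℕ) (f : ∀ j, Fin (n j) → ℝ)
    (p : ∀ j, Fin (n j) → Prop) [∀ j x, Decidable (p j x)] :
    (∑ w : ∀ j, Fin (n j), if (∀ j, p j (w j)) then ∏ j, f j (w j) else 0)
      = ∏ j, ∑ x, if p j x then f j x else 0 := by
  rw [Finset.prod_univ_sum, Fintype.piFinset_univ]
  refine Finset.sum_congr rfl fun w _ => ?_
  rw [Finset.prod_ite_zero]
  simp

theorem cum_basis {k : ℕ} (n : Fin k → ℕ) (i i' : (j : Fin k) → Fin (n j - 1)) :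
    cumMap n (fun j => i' j) (basisTable n i) = if i = i' then 1 else 0 := by
  have h := sum_prod_fac n (fun j x => if (x : ℕ) = (i j : ℕ) then (1 : ℝ)
      else if (x : ℕ) = (i j : ℕ) + 1 then -1 else 0) (fun j x => (x : ℕ) ≤ i' j)
  refine h.trans ?_
  simp only [one_dim]
  rw [Finset.prod_ite_zero]
  simp [funext_iff, Fin.ext_iff]

theorem mem_zero {k : ℕ} (n : Fin k → ℕ) (Z : (∀ j, Fin (n j)) → ℝ) :
    Z ∈ zeroMarginSpace n ↔ ∀ R : Finset (Fin k), R ≠ Finset.univ →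
      ∀ v : (j : R) → Fin (n j.1), marginMap n R v Z = 0 := by
  simp [zeroMarginSpace, Submodule.mem_iInf]

theorem basis_mem {k : ℕ} (n : Fin k → ℕ) (i : (j : Fin k) → Fin (n j - 1)) :
    basisTable n i ∈ zeroMarginSpace n := by
  classical
  rw [mem_zero]
  intro R hR v
  obtain ⟨j0, hj0⟩ : ∃ j, j ∉ R := by
    by_contra! h
    exact hR (Finset.eq_univ_iff_forall.2 h)
  have h := sum_prod_fac n (fun j x => if (x : ℕ) = (i j : ℕ) then (1 : ℝ)
      else if (x : ℕ) = (i j : ℕ) + 1 then -1 else 0)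
      (fun j x => ∀ h : j ∈ R, x = v ⟨j, h⟩)
  refine Eq.trans ((Finset.sum_congr rfl fun w _ => ?_).trans h) ?_
  · simp only [Subtype.forall, basisTable]
  refine Finset.prod_eq_zero (Finset.mem_univ j0) ?_
  simp only [hj0, IsEmpty.forall_iff, if_true]
  exact one_dim_total _ _

theorem cum_top {k : ℕ} (n : Fin k → ℕ) (Z : (∀ j, Fin (n j)) → ℝ)
    (hZ : Z ∈ zeroMarginSpace n) (c : Fin k → ℕ) (j0 : Fin k) (hc : n j0 ≤ c j0 + 1) :
    cumMap n c Z = 0 := by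
  classical
  rw [mem_zero] at hZ
  set R : Finset (Fin k) := Finset.univ.erase j0 with hRdef
  have hR : R ≠ Finset.univ := by
    intro h
    have := Finset.mem_univ j0
    rw [← h] at this
    simp [hRdef] at this
  have key : cumMap n c Z = ∑ v : (j : R) → Fin (n j.1),
      if (∀ j : R, (v j : ℕ) ≤ c j.1) then marginMap n R v Z else 0 := by
    have e : ∀ v : (j : R) → Fin (n j.1),
        (if (∀ j : R, (v j : ℕ) ≤ c j.1) then marginMap n R v Z else 0)
        = ∑ w : ∀ j, Fin (n j), if v = (fun j : R => w j.1) then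
          (if (∀ j : R, (v j : ℕ) ≤ c j.1) then Z w else 0) else 0 := by
      intro v
      by_cases hv : ∀ j : R, (v j : ℕ) ≤ c j.1
      · simp only [if_pos hv]
        refine Finset.sum_congr rfl fun w _ => ?_
        refine if_congr ?_ rfl rfl
        rw [funext_iff]
        exact forall_congr' fun j => eq_comm
      · simp only [if_neg hv]; simp
    rw [Finset.sum_congr rfl fun v _ => e v, Finset.sum_comm]
    refine Finset.sum_congr rfl fun w _ => ?_
    rw [Finset.sum_ite_eq']
    simp only [Finset.mem_univ, if_true]
    refine if_congr ⟨fun h j => h j.1, fun h j => ?_⟩ rfl rfl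
    by_cases hj : j = j0
    · subst hj
      have := (w j).2
      omega
    · exact h ⟨j, by simp [hRdef, hj]⟩
  rw [key]
  refine Finset.sum_eq_zero fun v _ => ?_
  rw [hZ R hR v, ite_self]

theorem eq_zero_of_cum {k : ℕ} (n : Fin k → ℕ) (Z : (∀ j, Fin (n j)) → ℝ)
    (h : ∀ c : ∀ j, Fin (n j), cumMap n (fun j => c j) Z = 0) : Z = 0 := by
  funext c
  induction c using WellFoundedLT.induction with
  | ind c ih =>
    have hc : (∑ w : ∀ j, Fin (n j), if (∀ j, (w j : ℕ) ≤ c j) then Z w else 0) = 0 := h c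
    rw [Finset.sum_eq_single c] at hc
    · simpa using hc
    · intro w _ hw
      split_ifs with hle
      · exact ih w (lt_of_le_of_ne (fun j => hle j) hw)
      · rfl
    · simp

/-- The `∏_j (n j − 1)` tables `basisTable n i` are linearly independent
and span the zero-margin subspace `𝒮`; i.e. they form a basis of `𝒮`. -/
theorem stmt12 {k : ℕ} (n : Fin k → ℕ) (hn : ∀ j, 0 < n j) :
    LinearIndependent ℝ (basisTable n) ∧
    Submodule.span ℝ (Set.range (basisTable n)) = zeroMarginSpace n := by
  constructor
  · rw [Fintype.linearIndependent_iff]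
    intro g hg i
    have h := congrArg (cumMap n (fun j => i j)) hg
    simpa [map_sum, cum_basis] using h
  · apply le_antisymm
    · rw [Submodule.span_le]
      rintro _ ⟨i, rfl⟩
      exact basis_mem n i
    · intro Z hZ
      let W := ∑ i : (j : Fin k) → Fin (n j - 1), cumMap n (fun j => i j) Z • basisTable n i
      have hW : W ∈ Submodule.span ℝ (Set.range (basisTable n)) :=
        Submodule.sum_mem _ fun i _ => Submodule.smul_mem _ _ (Submodule.subset_span ⟨i, rfl⟩)
      have hWS : W ∈ zeroMarginSpace n :=
        Submodule.sum_mem _ fun i _ => Submodule.smul_mem _ _ (basis_mem n i)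
      have h0 : Z - W = 0 := by
        apply eq_zero_of_cum
        intro c
        by_cases hc : ∀ j, (c j : ℕ) < n j - 1
        · have := cum_basis n
          let i' : (j : Fin k) → Fin (n j - 1) := fun j => ⟨c j, hc j⟩
          change cumMap n (fun j => (i' j : ℕ)) (Z - W) = 0
          simp [W, map_sum, cum_basis]
        · push Not at hc
          obtain ⟨j0, hj0⟩ := hc
          exact cum_top n _ (Submodule.sub_mem _ hZ hWS) _ j0 (by omega)
      rw [sub_eq_zero.1 h0]
      exact hW
end

section
/- Let k ≥ 1 and I ≥ 1 be integers. Consider the direct sum, over all subsets S ⊆ {1,…,k}, of the spaces of tables Z^S : (S → Fin I) → ℝ; this direct sum has total dimension Σ_{S ⊆ {1,…,k}} I^{|S|} = (I+1)^k. Let W be the subspace of self-consistent families, i.e., families (Z^S)_{S ⊆ {1,…,k}} such that for all R ⊆ S, the R-margin of Z^S equals Z^R. Then the linear map sending a detailed table Z : ({1,…,k} → Fin I) → ℝ to the family of all of its margins is an injective linear map whose range is exactly W; consequently dim W = I^k, and the space of self-consistency constraints has rank (I+1)^k − I^k. -/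
/-- The linear functional sending a table `Z` on the variables in `S` (with `I` levels per
variable) to its `R`-margin at `v` (meaningful for `R ⊆ S`): the sum of `Z w` over all
cells `w` of `S` restricting to `v` on `R`. -/
noncomputable def marginMapT {k : ℕ} (I : ℕ) (S R : Finset (Fin k)) (v : (j : R) → Fin I) :
    (((j : S) → Fin I) → ℝ) →ₗ[ℝ] ℝ where
  toFun Z := ∑ w : (j : S) → Fin I,
    if (∀ (j : Fin k) (hS : j ∈ S) (hR : j ∈ R), w ⟨j, hS⟩ = v ⟨j, hR⟩) then Z w else 0
  map_add' Z W := by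
    rw [← Finset.sum_add_distrib]
    exact Finset.sum_congr rfl fun w _ => by split <;> simp
  map_smul' c Z := by
    simp only [Pi.smul_apply, smul_eq_mul, RingHom.id_apply]
    rw [Finset.mul_sum]
    exact Finset.sum_congr rfl fun w _ => by split <;> simp

/-- The linear functional sending a family `(Z^S)_S` to the `R`-margin of `Z^S` at `v`. -/
noncomputable def marginFam (k I : ℕ) (S R : Finset (Fin k)) (v : (j : R) → Fin I) :
    ((S' : Finset (Fin k)) → ((j : S') → Fin I) → ℝ) →ₗ[ℝ] ℝ :=
  (marginMapT I S R v).comp (LinearMap.proj S)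

/-- The linear functional sending a family `(Z^S)_S` to the entry `Z^R_v`. -/
noncomputable def evalFam (k I : ℕ) (R : Finset (Fin k)) (v : (j : R) → Fin I) :
    ((S' : Finset (Fin k)) → ((j : S') → Fin I) → ℝ) →ₗ[ℝ] ℝ :=
  (LinearMap.proj (R := ℝ) (φ := fun _ : (j : R) → Fin I => ℝ) v).comp
    (LinearMap.proj (R := ℝ) (φ := fun S' : Finset (Fin k) => ((j : S') → Fin I) → ℝ) R)

/-- The subspace `W` of self-consistent families `(Z^S)_{S ⊆ {1,…,k}}`: for all `R ⊆ S`,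
the `R`-margin of `Z^S` equals `Z^R`. -/
noncomputable def consistentFamilies (k I : ℕ) :
    Submodule ℝ ((S : Finset (Fin k)) → ((j : S) → Fin I) → ℝ) :=
  ⨅ (S : Finset (Fin k)) (R : Finset (Fin k)) (_ : R ⊆ S) (v : (j : R) → Fin I),
    LinearMap.ker (marginFam k I S R v - evalFam k I R v)

/-- The map sending a detailed table `Z : (Fin k → Fin I) → ℝ` to the family of all of its
margins. -/
noncomputable def allMargins (k I : ℕ) (Z : (Fin k → Fin I) → ℝ) :
    (S : Finset (Fin k)) → ((j : S) → Fin I) → ℝ :=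
  fun S v => ∑ w : Fin k → Fin I,
    if (∀ (j : Fin k) (hS : j ∈ S), w j = v ⟨j, hS⟩) then Z w else 0

theorem mem_consistentFamilies_iff (k I : ℕ) (Y : (S : Finset (Fin k)) → ((j : S) → Fin I) → ℝ) :
    Y ∈ consistentFamilies k I ↔ ∀ (S R : Finset (Fin k)), R ⊆ S → ∀ v : (j : R) → Fin I,
      (∑ w : (j : S) → Fin I,
        if (∀ (j : Fin k) (hS : j ∈ S) (hR : j ∈ R), w ⟨j, hS⟩ = v ⟨j, hR⟩) then Y S w else 0)
        = Y R v := by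
  simp only [consistentFamilies, Submodule.mem_iInf, LinearMap.mem_ker, LinearMap.sub_apply,
    sub_eq_zero]
  rfl

theorem allMargins_isLinearMap (k I : ℕ) : IsLinearMap ℝ (allMargins k I) where
  map_add Z W := by
    funext S v
    simp only [allMargins, Pi.add_apply]
    rw [← Finset.sum_add_distrib]
    exact Finset.sum_congr rfl fun w _ => by split <;> simp
  map_smul c Z := by
    funext S v
    simp only [allMargins, Pi.smul_apply, smul_eq_mul]
    rw [Finset.mul_sum]
    exact Finset.sum_congr rfl fun w _ => by split <;> simp

theorem allMargins_univ (k I : ℕ) (Z : (Fin k → Fin I) → ℝ) (u : Fin k → Fin I) :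
    allMargins k I Z Finset.univ (fun j => u j) = Z u := by
  unfold allMargins
  rw [Finset.sum_eq_single u]
  · simp
  · intro b _ hb
    rw [if_neg]
    intro h
    exact hb (funext fun j => h j (Finset.mem_univ j))
  · simp

theorem allMargins_injective (k I : ℕ) : Function.Injective (allMargins k I) := by
  intro Z W h
  funext u
  rw [← allMargins_univ k I Z u, h, allMargins_univ]

theorem allMargins_mem (k I : ℕ) (Z : (Fin k → Fin I) → ℝ) :
    allMargins k I Z ∈ consistentFamilies k I := by
  rw [mem_consistentFamilies_iff]
  intro S R hRS v
  unfold allMargins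
  have h1 : ∀ w : (j : S) → Fin I,
      (if (∀ (j : Fin k) (hS : j ∈ S) (hR : j ∈ R), w ⟨j, hS⟩ = v ⟨j, hR⟩) then
        (∑ u : Fin k → Fin I, if (∀ (j : Fin k) (hS : j ∈ S), u j = w ⟨j, hS⟩) then Z u else 0)
        else 0) = ∑ u : Fin k → Fin I,
        if (∀ (j : Fin k) (hS : j ∈ S) (hR : j ∈ R), w ⟨j, hS⟩ = v ⟨j, hR⟩) then
        (if (∀ (j : Fin k) (hS : j ∈ S), u j = w ⟨j, hS⟩) then Z u else 0) else 0 := by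
    intro w
    split_ifs <;> simp
  rw [Finset.sum_congr rfl fun w _ => h1 w, Finset.sum_comm]
  refine Finset.sum_congr rfl fun u _ => ?_
  rw [Finset.sum_eq_single (fun j : S => u j)]
  · simp only [implies_true, if_true]
    refine if_congr ⟨fun h j hR => h j (hRS hR) hR, fun h j _ hR => h j hR⟩ rfl rfl
  · intro b _ hb
    have : ¬ ∀ (j : Fin k) (hS : j ∈ S), u j = b ⟨j, hS⟩ := fun h =>
      hb (funext fun j => (h j j.2).symm)
    rw [if_neg this, ite_self]
  · simp

theorem allMargins_surj (k I : ℕ) (Y : (S : Finset (Fin k)) → ((j : S) → Fin I) → ℝ)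
    (hY : Y ∈ consistentFamilies k I) :
    allMargins k I (fun u => Y Finset.univ (fun j => u j)) = Y := by
  rw [mem_consistentFamilies_iff] at hY
  funext S v
  rw [← hY Finset.univ S (Finset.subset_univ S) v]
  unfold allMargins
  refine Fintype.sum_bijective (fun (u : Fin k → Fin I) (j : (Finset.univ : Finset (Fin k))) => u j)
    ⟨?_, ?_⟩ _ _ ?_
  · intro a b h
    funext j
    exact congrFun h ⟨j, Finset.mem_univ j⟩
  · intro w
    exact ⟨fun j => w ⟨j, Finset.mem_univ j⟩, rfl⟩
  · intro u
    simp

theorem finrank_families (k I : ℕ) :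
    Module.finrank ℝ ((S : Finset (Fin k)) → ((j : S) → Fin I) → ℝ) = (I + 1) ^ k := by
  rw [Module.finrank_pi_fintype]
  have h := Fintype.sum_pow_mul_eq_add_pow (Fin k) I 1
  simpa using h

/-- For `k ≥ 1`, `I ≥ 1`, the direct sum over all `S ⊆ {1,…,k}` of the
spaces of tables on `S` has total dimension `∑_S I^{|S|} = (I+1)^k`; the map sending a
detailed table to the family of all of its margins is an injective linear map whose range
is exactly the subspace `W` of self-consistent families; consequently `dim W = I^k` and
the self-consistency constraints have rank `(I+1)^k − I^k` (the codimension of `W`). -/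
theorem stmt13 (k I : ℕ) (hk : 1 ≤ k) (hI : 1 ≤ I) :
    Module.finrank ℝ ((S : Finset (Fin k)) → ((j : S) → Fin I) → ℝ) = (I + 1) ^ k ∧
    IsLinearMap ℝ (allMargins k I) ∧
    Function.Injective (allMargins k I) ∧
    Set.range (allMargins k I) = (consistentFamilies k I : Set _) ∧
    Module.finrank ℝ (consistentFamilies k I) = I ^ k ∧
    Module.finrank ℝ
      (((S : Finset (Fin k)) → ((j : S) → Fin I) → ℝ) ⧸ consistentFamilies k I) =
        (I + 1) ^ k - I ^ k := by
  have hr : Set.range (allMargins k I) = (consistentFamilies k I : Set _) := by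
    ext Y
    constructor
    · rintro ⟨Z, rfl⟩
      exact allMargins_mem k I Z
    · intro hY
      exact ⟨_, allMargins_surj k I Y hY⟩
  have hd : Module.finrank ℝ (consistentFamilies k I) = I ^ k := by
    have e : LinearMap.range (IsLinearMap.mk' _ (allMargins_isLinearMap k I))
        = consistentFamilies k I := SetLike.coe_injective (by
          rw [← hr, LinearMap.coe_range]; rfl)
    rw [← e, LinearMap.finrank_range_of_inj (allMargins_injective k I)]
    simp
  refine ⟨finrank_families k I, allMargins_isLinearMap k I, allMargins_injective k I, hr, hd, ?_⟩
  rw [Submodule.finrank_quotient, finrank_families, hd]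
end
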